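/- arXiv:1509.02143 — 4 statements merged into one kernel-verified Lean document; each statement's English description precedes it below -/
import Mathlib

section
/- If G is a graph with n vertices and average degree d = 2|E(G)|/n, then f(G) ≥ ⌊1/2 + √d⌋; that is, every edge-ordering of G contains a monotone path of length at least ⌊1/2 + √d⌋. -/
namespace AltitudePaper

variable {V : Type*}

/-- A monotone path in the edge-ordered graph `(G, oe)` (where `oe` is a linear order
on edges): a path traversing its edges in increasing order of the edge ordering. -/
def IsMonotonePath (G : SimpleGraph V) (oe : LinearOrder (Sym2 V)) {u v : V}
    (p : G.Walk u v) : Prop :=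
  p.IsPath ∧ List.Chain' (fun e f => oe.lt e f) p.edges


open Classical in
theorem exists_top {α : Type*} [LinearOrder α] (s : Finset α) (k : ℕ) :
    ∃ R ⊆ s, R.card ≤ k ∧ ∀ e ∈ s, e ∉ R → R.card = k ∧ ∀ r ∈ R, e < r := by
  induction k with
  | zero => exact ⟨∅, by simp, by simp, by simp⟩
  | succ k ih =>
    obtain ⟨R, hRs, hc, hR⟩ := ih
    by_cases hne : (s \ R).Nonempty
    · obtain ⟨m, hm, hmax⟩ := Finset.exists_max_image (s \ R) id hne
      simp only [id, Finset.mem_sdiff] at hm hmax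
      refine ⟨insert m R, ?_, ?_, ?_⟩
      · intro x hx
        rcases Finset.mem_insert.1 hx with rfl | h
        · exact hm.1
        · exact hRs h
      · rw [Finset.card_insert_of_notMem hm.2]; omega
      · intro e he heR
        simp only [Finset.mem_insert, not_or] at heR
        obtain ⟨h1, h2⟩ := hR e he heR.2
        refine ⟨by rw [Finset.card_insert_of_notMem hm.2, h1], ?_⟩
        intro r hr
        rcases Finset.mem_insert.1 hr with rfl | h
        · exact lt_of_le_of_ne (hmax e ⟨he, heR.2⟩) heR.1
        · exact h2 r h
    · refine ⟨R, hRs, by omega, ?_⟩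
      intro e he heR
      exact absurd ⟨e, Finset.mem_sdiff.2 ⟨he, heR⟩⟩ hne

open Classical in
theorem exists_dec {V : Type*} [Fintype V] (oe : LinearOrder (Sym2 V)) (k : ℕ) :
    ∀ G : SimpleGraph V, (k + 1).choose 2 * Fintype.card V < G.edgeFinset.card →
    ∃ (u v : V) (p : G.Walk u v), p.IsPath ∧
      List.IsChain (fun e f => oe.lt f e) p.edges ∧ p.length = k + 1 := by
  induction k with
  | zero =>
    intro G hG
    have : 0 < G.edgeFinset.card := by omega
    obtain ⟨e, he⟩ := Finset.card_pos.1 this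
    induction e using Sym2.ind with
    | _ x y =>
      have h : G.Adj x y := by simpa using he
      refine ⟨x, y, h.toWalk, ?_, ?_, ?_⟩
      · simp [SimpleGraph.Walk.cons_isPath_iff, h.ne]
      · simp
      · simp
  | succ k ih =>
    intro G hG
    choose R hRs hRc hR using fun v : V => @exists_top _ oe (G.incidenceFinset v) (k + 1)
    let U : Finset (Sym2 V) := Finset.univ.biUnion R
    have hU : U.card ≤ Fintype.card V * (k + 1) := by
      have := Finset.card_biUnion_le_card_mul Finset.univ R (k + 1) (fun v _ => hRc v)
      simpa using this
    let G' := G.deleteEdges (U : Set (Sym2 V))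
    have hG' : G'.edgeFinset = G.edgeFinset \ U := by
      ext e; simp [G']
    have hle : G' ≤ G := SimpleGraph.deleteEdges_le _
    obtain ⟨v, u, p, hp, hch, hlen⟩ := ih G' (by
      suffices h0 : (k + 1).choose 2 * Fintype.card V < (G.edgeFinset \ U).card by
        rw [← hG'] at h0
        convert h0
      have h1 := Finset.le_card_sdiff U G.edgeFinset
      have h2 : (k + 1 + 1).choose 2 = (k + 1) + (k + 1).choose 2 := by
        rw [Nat.choose_succ_succ' (k + 1) 1]; simp
      rw [h2] at hG
      have : (k + 1 + (k + 1).choose 2) * Fintype.card V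
        = Fintype.card V * (k + 1) + (k + 1).choose 2 * Fintype.card V := by ring
      omega)
    cases p with
    | nil => simp at hlen
    | @cons _ w _ h q =>
      have hvw : G.Adj v w := hle h
      have hnU : s(v, w) ∉ U := by
        have := h
        simp only [G', SimpleGraph.deleteEdges_adj] at this
        simpa using this.2
      have hnR : s(v, w) ∉ R v := fun hh =>
        hnU (Finset.mem_biUnion.2 ⟨v, Finset.mem_univ _, hh⟩)
      obtain ⟨hcard, hlt⟩ := hR v s(v, w) (by
        simp [SimpleGraph.mem_incidenceFinset, SimpleGraph.incidenceSet, hvw]) hnR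
      have hex : ∃ x, s(v, x) ∈ R v ∧ x ∉ q.support ∧ x ≠ v := by
        by_contra hcon
        push Not at hcon
        have hsub : R v ⊆ (q.support.toFinset.erase w).image (fun x => s(v, x)) := by
          intro e he
          have hinc := hRs v he
          rw [SimpleGraph.mem_incidenceFinset] at hinc
          obtain ⟨x, rfl⟩ := Sym2.mem_iff_exists.1 hinc.2
          have hadj : G.Adj v x := hinc.1
          have hxw : x ≠ w := by
            rintro rfl
            exact hnR he
          refine Finset.mem_image.2 ⟨x, ?_, rfl⟩
          rw [Finset.mem_erase, List.mem_toFinset]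
          refine ⟨hxw, ?_⟩
          by_contra hx
          exact hadj.ne (hcon x he hx).symm
        have h1 := (Finset.card_le_card hsub).trans Finset.card_image_le
        rw [Finset.card_erase_of_mem (by simp)] at h1
        have h2 := q.support.toFinset_card_le
        rw [SimpleGraph.Walk.length_support] at h2
        simp only [SimpleGraph.Walk.length_cons] at hlen
        omega
      obtain ⟨x, hxR, hxq, hxv⟩ := hex
      have hadj : G.Adj x v := by
        have hinc := hRs v hxR
        rw [SimpleGraph.mem_incidenceFinset] at hinc
        exact (show G.Adj v x from hinc.1).symm
      refine ⟨x, u, SimpleGraph.Walk.cons hadj ((SimpleGraph.Walk.cons h q).mapLe hle), ?_, ?_, ?_⟩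
      · rw [SimpleGraph.Walk.cons_isPath_iff]
        refine ⟨(SimpleGraph.Walk.isPath_mapLe hle).2 hp, ?_⟩
        rw [SimpleGraph.Walk.support_mapLe_eq_support]
        simp [hxq, hxv]
      · rw [SimpleGraph.Walk.edges_cons, SimpleGraph.Walk.edges_mapLe_eq_edges]
        rw [SimpleGraph.Walk.edges_cons] at hch ⊢
        refine List.isChain_cons_cons.2 ⟨?_, hch⟩
        have := hlt _ hxR
        rwa [Sym2.eq_swap (a := v) (b := x)] at this
      · simp only [SimpleGraph.Walk.length_cons, SimpleGraph.Walk.length_map,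
          SimpleGraph.Walk.mapLe] at hlen ⊢
        omega

/-- If `G` is a graph with `n` vertices and average degree
`d = 2|E(G)|/n`, then every edge-ordering of `G` contains a monotone path of length
at least `⌊1/2 + √d⌋`. -/
theorem altitude_ge_sqrt_avg_degree {V : Type*} [Fintype V] [Nonempty V]
    (G : SimpleGraph V) (n : ℕ) (hn : Fintype.card V = n) (d : ℝ)
    (hd : d = 2 * G.edgeSet.ncard / n) (oe : LinearOrder (Sym2 V)) :
    ∃ (u v : V) (p : G.Walk u v),
      IsMonotonePath G oe p ∧ ⌊1 / 2 + Real.sqrt d⌋₊ ≤ p.length := by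
  classical
  obtain hk | ⟨k, hk⟩ : ⌊1 / 2 + Real.sqrt d⌋₊ = 0 ∨ ∃ k, ⌊1 / 2 + Real.sqrt d⌋₊ = k + 1 := by
    cases ⌊1 / 2 + Real.sqrt d⌋₊ with
    | zero => exact Or.inl rfl
    | succ k => exact Or.inr ⟨k, rfl⟩
  · obtain ⟨v⟩ := ‹Nonempty V›
    exact ⟨v, v, SimpleGraph.Walk.nil, ⟨by simp, List.isChain_nil⟩, by rw [hk]; exact Nat.zero_le _⟩
  · have hnpos : (0 : ℝ) < n := by
      rw [← hn]; exact_mod_cast Fintype.card_pos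
    have hd0 : 0 ≤ d := by rw [hd]; positivity
    have hfl : ((k + 1 : ℕ) : ℝ) ≤ 1 / 2 + Real.sqrt d := by
      rw [← hk]; exact Nat.floor_le (by positivity)
    have hsq := Real.sq_sqrt hd0
    push_cast at hfl
    have hk0 : (0 : ℝ) ≤ k := Nat.cast_nonneg k
    have hdk : ((k : ℝ) + 1) * k < d := by nlinarith
    have hE : G.edgeSet.ncard = G.edgeFinset.card := by
      rw [← SimpleGraph.coe_edgeFinset, Set.ncard_coe_finset]
    have hmain : (k + 1).choose 2 * Fintype.card V < G.edgeFinset.card := by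
      rw [hn]
      rw [hd, hE, lt_div_iff₀ hnpos] at hdk
      have h2 : 2 * (k + 1).choose 2 = (k + 1) * k := by
        have := Nat.triangle_succ k
        rw [Nat.choose_two_right, Nat.mul_div_cancel' (Nat.even_mul_pred_self _).two_dvd]
        simp
      have h3 : (k + 1) * k * n < 2 * G.edgeFinset.card := by exact_mod_cast hdk
      rw [← h2, mul_assoc] at h3
      omega
    obtain ⟨u, v, p, hp, hch, hlen⟩ := exists_dec oe k G hmain
    refine ⟨v, u, p.reverse, ⟨hp.reverse, ?_⟩, by rw [hk, SimpleGraph.Walk.length_reverse, hlen]⟩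
    rw [SimpleGraph.Walk.edges_reverse]
    exact List.isChain_reverse.2 hch

end AltitudePaper
end

section
/- For all positive integers n ≥ 2 and s, one has ĝ(n,s) ≤ 4·lg n·(√(2ns) + 1) + s + 1, where lg denotes the base-2 logarithm. -/
namespace AltitudePaper

/-- The contents of one column after its ungrounded tokens each shift down one cell.
A column is a set of occupied rows; its grounded tokens are the initial segment
`[0, sInf Tᶜ)`, which stay put, and every ungrounded token moves down one row. -/
def shiftDown (T : Set ℕ) : Set ℕ :=
  {i | i ∈ T ∧ i < sInf Tᶜ} ∪ {i | sInf Tᶜ ≤ i ∧ i + 1 ∈ T}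

/-- A token game (together with a play of it).  `board t` is the array `B_t` (for
`0 ≤ t ≤ len`): each column (indexed by `Fin n`) is the set of rows occupied by
tokens.  `active t` is the active column at step `t`, advancing cyclically.  `move t`
records the player's optional move at step `t`: `some (v, i, i')` means the highest
grounded token of the active column, in row `i`, is moved to the empty cell in
row `i' ≤ i` of column `v` (allowed only if no earlier step moved a token between
these two columns); afterwards the ungrounded tokens of the active column shift down
one cell. -/
structure TokenGame (n : ℕ) where
  /-- number of steps -/
  len : ℕ
  /-- the array after `t` steps: each column is the set of rows occupied by tokens -/
  board : ℕ → Fin n → Set ℕ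
  /-- the active column at each step -/
  active : ℕ → Fin n
  /-- the optional move at each step: target column, source row, target row -/
  move : ℕ → Option (Fin n × ℕ × ℕ)
  /-- the active column advances cyclically -/
  active_succ : ∀ t, (active (t + 1)).val = ((active t).val + 1) % n
  /-- a step with no token moved: the ungrounded tokens of the active column shift
  down one cell -/
  step_none : ∀ t < len, move t = none →
    ∀ w, board (t + 1) w =
      if w = active t then shiftDown (board t (active t)) else board t w
  /-- a step moving a token: the token moved is the highest grounded token of the
  active column, it moves to an empty cell in a weakly lower row of another column,
  no earlier step moved a token between these two columns, and then the ungrounded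
  tokens of the active column shift down one cell -/
  step_some : ∀ t < len, ∀ v i i', move t = some (v, i, i') →
    v ≠ active t ∧
    (∀ j ≤ i, j ∈ board t (active t)) ∧ i + 1 ∉ board t (active t) ∧
    i' ≤ i ∧ i' ∉ board t v ∧
    (∀ t' < t, ∀ v' i₀ i₀', move t' = some (v', i₀, i₀') →
      ¬((active t' = active t ∧ v' = v) ∨ (active t' = v ∧ v' = active t))) ∧
    (∀ w, board (t + 1) w =
      if w = active t then shiftDown (board t (active t) \ {i})
      else if w = v then insert i' (board t v) else board t w)

/-- The number of transfer steps (steps moving a token between two columns) of a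
token game. -/
def transferCount {n : ℕ} (g : TokenGame n) : ℕ :=
  ((Finset.range g.len).filter fun t => (g.move t).isSome).card

/-- The number of transfer steps among steps `t₁ ≤ t < t₂` of a token game;
these are the transfer steps of the subgame with transcript `B_{t₁}, …, B_{t₂}`. -/
def transferCountBetween {n : ℕ} (g : TokenGame n) (t₁ t₂ : ℕ) : ℕ :=
  ((Finset.Ico t₁ t₂).filter fun t => (g.move t).isSome).card

/-- `ĝ(n, s)`: the maximum number of tokens that can be placed in a single column in
an `(n,s)`-token game (a token game with `n` columns, each initially containing at
most `s` tokens). -/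
noncomputable def ghat (n s : ℕ) : ℕ :=
  sSup {k | ∃ g : TokenGame n, (∀ u, (g.board 0 u).Finite) ∧
    (∀ u, (g.board 0 u).ncard ≤ s) ∧ ∃ t ≤ g.len, ∃ u, k = (g.board t u).ncard}


/-- number of tokens in rows at least `r` -/
noncomputable def hi (r : ℕ) (T : Set ℕ) : ℕ := {i | i ∈ T ∧ r ≤ i}.ncard

theorem hi_zero (T : Set ℕ) : hi 0 T = T.ncard := by simp [hi]

theorem hi_le (r : ℕ) {T : Set ℕ} (hT : T.Finite) : hi r T ≤ T.ncard :=
  Set.ncard_le_ncard (fun _ h => h.1) hT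

theorem ncard_le_hi (r : ℕ) {T : Set ℕ} (hT : T.Finite) : T.ncard ≤ hi r T + r := by
  have h1 : T ⊆ {i | i ∈ T ∧ r ≤ i} ∪ (Finset.range r : Set ℕ) := by
    intro i hi
    by_cases h : r ≤ i
    · exact Or.inl ⟨hi, h⟩
    · right; simpa using h
  have hf : {i | i ∈ T ∧ r ≤ i}.Finite := hT.subset fun _ h => h.1
  refine (Set.ncard_le_ncard h1 (hf.union (Finset.finite_toSet _))).trans ?_
  refine (Set.ncard_union_le _ _).trans ?_
  rw [Set.ncard_coe_finset]
  simp [hi]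

theorem hi_mono (r : ℕ) {S T : Set ℕ} (hT : T.Finite) (h : S ⊆ T) : hi r S ≤ hi r T :=
  Set.ncard_le_ncard (fun _ hx => ⟨h hx.1, hx.2⟩) (hT.subset fun _ h => h.1)

/-- the row a token came from before the shift -/
def unshift (h i : ℕ) : ℕ := if i < h then i else i + 1

theorem unshift_inj (h : ℕ) : Function.Injective (unshift h) := by
  intro a b hab
  unfold unshift at hab
  split_ifs at hab <;> omega

theorem unshift_mem {T : Set ℕ} {i : ℕ} (hi : i ∈ shiftDown T) :
    unshift (sInf Tᶜ) i ∈ T := by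
  unfold unshift
  rcases hi with h | h
  · rw [if_pos h.2]; exact h.1
  · rw [if_neg (not_lt.2 h.1)]; exact h.2

theorem shiftDown_finite {T : Set ℕ} (hT : T.Finite) : (shiftDown T).Finite :=
  (hT.preimage (unshift_inj (sInf Tᶜ)).injOn).subset fun _ h => unshift_mem h

theorem hi_shiftDown (r : ℕ) {T : Set ℕ} (hT : T.Finite) : hi r (shiftDown T) ≤ hi r T := by
  refine Set.ncard_le_ncard_of_injOn (unshift (sInf Tᶜ)) ?_ (unshift_inj _).injOn
    (hT.subset fun _ h => h.1)
  rintro i ⟨h1, h2⟩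
  refine ⟨unshift_mem h1, ?_⟩
  unfold unshift
  split_ifs <;> omega

theorem ncard_shiftDown {T : Set ℕ} (hT : T.Finite) : (shiftDown T).ncard ≤ T.ncard := by
  simpa [hi_zero] using hi_shiftDown 0 hT

variable {n : ℕ}

theorem board_finite (g : TokenGame n) (h0 : ∀ u, (g.board 0 u).Finite) :
    ∀ t ≤ g.len, ∀ u, (g.board t u).Finite := by
  intro t
  induction t with
  | zero => intro _; exact h0
  | succ t ih =>
    intro ht u
    have ih := ih (by omega)
    rcases hm : g.move t with _ | ⟨v, i, i'⟩
    · rw [g.step_none t (by omega) hm]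
      split_ifs
      · exact shiftDown_finite (ih _)
      · exact ih _
    · obtain ⟨-, -, -, -, -, -, h⟩ := g.step_some t (by omega) v i i' hm
      rw [h]
      split_ifs
      · exact shiftDown_finite ((ih _).subset Set.sdiff_subset)
      · exact (ih _).insert _
      · exact ih _

theorem total_le (g : TokenGame n) (h0 : ∀ u, (g.board 0 u).Finite) (s : ℕ)
    (hs : ∀ u, (g.board 0 u).ncard ≤ s) :
    ∀ t ≤ g.len, ∑ u, (g.board t u).ncard ≤ n * s := by
  intro t
  induction t with
  | zero =>
    intro _
    calc _ ≤ ∑ _u : Fin n, s := Finset.sum_le_sum fun u _ => hs u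
      _ = n * s := by simp
  | succ t ih =>
    intro ht
    have ih := ih (by omega)
    have hf := board_finite g h0 t (by omega)
    refine le_trans ?_ ih
    rcases hm : g.move t with _ | ⟨v, i, i'⟩
    · refine Finset.sum_le_sum fun u _ => ?_
      rw [g.step_none t (by omega) hm]
      split_ifs with h
      · subst h; exact ncard_shiftDown (hf _)
      · exact le_rfl
    · obtain ⟨hv, hg, -, -, -, -, h⟩ := g.step_some t (by omega) v i i' hm
      have key : ∀ u, (g.board (t+1) u).ncard + (if u = g.active t then 1 else 0) ≤
          (g.board t u).ncard + (if u = v then 1 else 0) := by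
        intro u
        rw [h]
        by_cases h1 : u = g.active t
        · have h2 : u ≠ v := fun h => hv (h ▸ h1)
          rw [if_pos h1, if_pos h1, if_neg h2, h1]
          have h3 := ncard_shiftDown ((hf (g.active t)).subset
            (Set.sdiff_subset (t := {i})))
          have h4 := Set.ncard_sdiff_singleton_add_one (hg i le_rfl) (hf (g.active t))
          omega
        · rw [if_neg h1, if_neg h1]
          by_cases h2 : u = v
          · rw [if_pos h2, if_pos h2, h2]
            have := Set.ncard_insert_le i' (g.board t v)
            omega
          · rw [if_neg h2, if_neg h2]
      have := Finset.sum_le_sum fun u (_ : u ∈ Finset.univ) => key u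
      simp only [Finset.sum_add_distrib, Finset.sum_ite_eq', Finset.mem_univ, if_true] at this
      omega

/-- step `t` moves a token into row at least `r` of column `u` -/
def Into (g : TokenGame n) (u : Fin n) (r t : ℕ) : Prop :=
  ∃ i i', g.move t = some (u, i, i') ∧ r ≤ i'

open Classical in
theorem hi_step (g : TokenGame n) (h0 : ∀ u, (g.board 0 u).Finite) (u : Fin n) (r t : ℕ)
    (ht : t < g.len) :
    hi r (g.board (t+1) u) ≤ hi r (g.board t u) + (if Into g u r t then 1 else 0) := by
  have hf := board_finite g h0 t ht.le
  rcases hm : g.move t with _ | ⟨v, i, i'⟩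
  · rw [g.step_none t ht hm]
    split_ifs with h
    all_goals first
      | (subst h; exact (hi_shiftDown r (hf _)).trans (Nat.le_add_right _ _))
      | exact Nat.le_add_right _ _
  · obtain ⟨hv, hg, -, -, -, -, h⟩ := g.step_some t ht v i i' hm
    rw [h]
    by_cases h1 : u = g.active t
    · rw [if_pos h1, h1]
      refine le_trans ?_ (Nat.le_add_right _ _)
      exact (hi_shiftDown r ((hf _).subset Set.sdiff_subset)).trans
        (hi_mono r (hf _) Set.sdiff_subset)
    · rw [if_neg h1]
      by_cases h2 : u = v
      · rw [if_pos h2]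
        subst h2
        by_cases h3 : r ≤ i'
        · rw [if_pos ⟨i, i', hm, h3⟩]
          have : {j | j ∈ insert i' (g.board t u) ∧ r ≤ j} ⊆
              insert i' {j | j ∈ g.board t u ∧ r ≤ j} := by
            rintro j ⟨hj | hj, hr⟩
            · exact Or.inl hj
            · exact Or.inr ⟨hj, hr⟩
          exact (Set.ncard_le_ncard this (((hf u).subset fun _ h => h.1).insert _)).trans
            (Set.ncard_insert_le _ _)
        · refine le_trans ?_ (Nat.le_add_right _ _)
          refine Set.ncard_le_ncard ?_ ((hf u).subset fun _ h => h.1)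
          rintro j ⟨hj | hj, hr⟩
          · exact absurd (hj ▸ hr) h3
          · exact ⟨hj, hr⟩
      · rw [if_neg h2]; exact Nat.le_add_right _ _

open Classical in
theorem hi_growth (g : TokenGame n) (h0 : ∀ u, (g.board 0 u).Finite) (u : Fin n) (r a b : ℕ)
    (hab : a ≤ b) (hb : b ≤ g.len) :
    hi r (g.board b u) ≤ hi r (g.board a u) + ((Finset.Ico a b).filter (Into g u r)).card := by
  induction b, hab using Nat.le_induction with
  | base => simp
  | succ b hab ih =>
    have h1 := ih (by omega)
    have h2 := hi_step g h0 u r b hb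
    rw [Finset.card_filter] at h1 ⊢
    rw [Finset.sum_Ico_succ_top hab]
    omega

theorem growth_le_transfer (g : TokenGame n) (h0 : ∀ u, (g.board 0 u).Finite) (u : Fin n)
    (a b : ℕ) (hab : a ≤ b) (hb : b ≤ g.len) :
    (g.board b u).ncard ≤ (g.board a u).ncard + transferCountBetween g a b := by
  classical
  have := hi_growth g h0 u 0 a b hab hb
  rw [hi_zero, hi_zero] at this
  refine this.trans (Nat.add_le_add_left (Finset.card_le_card ?_) _)
  intro t
  simp only [Finset.mem_filter]
  rintro ⟨h1, i, i', h, -⟩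
  exact ⟨h1, by simp [h]⟩

theorem tcb_mono (g : TokenGame n) {a a' b b' : ℕ} (h1 : a ≤ a') (h2 : b' ≤ b) :
    transferCountBetween g a' b' ≤ transferCountBetween g a b :=
  Finset.card_le_card (Finset.filter_subset_filter _ (Finset.Ico_subset_Ico h1 h2))

theorem tcb_succ (g : TokenGame n) {a b : ℕ} (h : a ≤ b) :
    transferCountBetween g a (b+1) ≤ transferCountBetween g a b + 1 := by
  unfold transferCountBetween
  rw [Finset.card_filter, Finset.card_filter, Finset.sum_Ico_succ_top h]
  split_ifs <;> omega

theorem tcb_add (g : TokenGame n) {a b c : ℕ} (h : a ≤ b) (h' : b ≤ c) :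
    transferCountBetween g a b + transferCountBetween g b c = transferCountBetween g a c := by
  unfold transferCountBetween
  rw [Finset.card_filter, Finset.card_filter, Finset.card_filter,
    Finset.sum_Ico_consecutive _ h h']

theorem tcb_ivt (g : TokenGame n) {a b : ℕ} (h : a ≤ b) (K : ℕ)
    (hK : K ≤ transferCountBetween g a b) :
    ∃ T, a ≤ T ∧ T ≤ b ∧ transferCountBetween g a T = K := by
  induction b, h using Nat.le_induction with
  | base => exact ⟨a, le_rfl, le_rfl, by simp [transferCountBetween] at hK ⊢; omega⟩
  | succ b hab ih =>
    by_cases h : K ≤ transferCountBetween g a b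
    · obtain ⟨T, h1, h2, h3⟩ := ih h
      exact ⟨T, h1, by omega, h3⟩
    · have := tcb_succ g hab
      exact ⟨b+1, by omega, le_rfl, by omega⟩

theorem tcb_split (g : TokenGame n) {a b : ℕ} (h : a ≤ b) (K : ℕ)
    (hK : transferCountBetween g a b ≤ 2 * K) :
    ∃ T, a ≤ T ∧ T ≤ b ∧ transferCountBetween g a T ≤ K ∧ transferCountBetween g T b ≤ K := by
  by_cases h1 : K ≤ transferCountBetween g a b
  · obtain ⟨T, h2, h3, h4⟩ := tcb_ivt g h K h1
    have := tcb_add g h2 h3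
    exact ⟨T, h2, h3, by omega, by omega⟩
  · exact ⟨b, h, le_rfl, by omega, by simp [transferCountBetween]⟩

open Classical in
/-- If many tokens are moved to high rows of `u`, some sender grew a lot. -/
theorem sender (g : TokenGame n) (h0 : ∀ u, (g.board 0 u).Finite) (s : ℕ)
    (hs : ∀ u, (g.board 0 u).ncard ≤ s) (u : Fin n) (r a b e : ℕ) (he : 0 < e)
    (hab : a ≤ b) (hb : b ≤ g.len)
    (hcard : e ≤ ((Finset.Ico a b).filter (Into g u r)).card) :
    ∃ t v, a ≤ t ∧ t ≤ b ∧ (g.board a v).ncard ≤ n * s / e ∧ r + 1 ≤ (g.board t v).ncard := by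
  set F := (Finset.Ico a b).filter (Into g u r) with hF
  have hinj : Set.InjOn g.active (F : Set ℕ) := by
    have key : ∀ t ∈ F, ∀ t' ∈ F, t' < t → g.active t' ≠ g.active t := by
      intro t ht t' ht' hlt heq
      rw [hF, Finset.mem_filter, Finset.mem_Ico] at ht ht'
      obtain ⟨hr, i, i', hm, -⟩ := ht
      obtain ⟨hr', j, j', hm', -⟩ := ht'
      obtain ⟨-, -, -, -, -, h, -⟩ := g.step_some t (by omega) u i i' hm
      exact h t' hlt u j j' hm' (Or.inl ⟨heq, rfl⟩)
    intro t ht t' ht' heq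
    by_contra hne
    rcases Nat.lt_or_gt_of_ne hne with h | h
    · exact key t' ht' t ht h heq
    · exact key t ht t' ht' h heq.symm
  have : ∃ t ∈ F, (g.board a (g.active t)).ncard ≤ n * s / e := by
    by_contra! hcon
    have h1 : ∑ t ∈ F, (g.board a (g.active t)).ncard ≤ n * s := by
      rw [← Finset.sum_image (f := fun v => (g.board a v).ncard) hinj]
      exact (Finset.sum_le_sum_of_subset (Finset.subset_univ _)).trans
        (total_le g h0 s hs a (by omega))
    have h2 : F.card * (n * s / e + 1) ≤ ∑ t ∈ F, (g.board a (g.active t)).ncard := by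
      rw [← smul_eq_mul]
      exact Finset.card_nsmul_le_sum _ _ _ fun t ht => hcon t ht
    have h3 : e * (n * s / e + 1) ≤ n * s :=
      (Nat.mul_le_mul_right _ hcard).trans (h2.trans h1)
    have h4 := Nat.lt_mul_div_succ (n * s) he
    omega
  obtain ⟨t, ht, hle⟩ := this
  rw [hF, Finset.mem_filter, Finset.mem_Ico] at ht
  obtain ⟨hr, i, i', hm, hri⟩ := ht
  refine ⟨t, g.active t, hr.1, hr.2.le, hle, ?_⟩
  obtain ⟨-, hg, -, hii, -, -, -⟩ := g.step_some t (by omega) u i i' hm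
  have hsub : (Finset.range (r+1) : Set ℕ) ⊆ g.board t (g.active t) := by
    intro j hj
    have : j < r + 1 := by simpa using hj
    exact hg j (by omega)
  have := Set.ncard_le_ncard hsub (board_finite g h0 t (by omega) _)
  rwa [Set.ncard_coe_finset, Finset.card_range] at this

theorem growth_bound (g : TokenGame n) (h0 : ∀ u, (g.board 0 u).Finite) (s : ℕ)
    (hs : ∀ u, (g.board 0 u).ncard ≤ s) (e : ℕ) (he : 0 < e) (c : ℕ)
    (hc0 : n * s / e = c) (j : ℕ) :
    ∀ a b, a ≤ b → b ≤ g.len → transferCountBetween g a b ≤ 2 ^ j → ∀ u,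
      (g.board b u).ncard ≤ (g.board a u).ncard + j * (2 * (e - 1) + c) + 1 := by
  classical
  induction j with
  | zero =>
    intro a b hab hb hc u
    have := growth_le_transfer g h0 u a b hab hb
    simp only [pow_zero] at hc
    omega
  | succ j ih =>
    intro a b hab hb hc u
    by_contra! hcon
    rw [pow_succ'] at hc
    obtain ⟨T, haT, hTb, hT1, hT2⟩ := tcb_split g hab _ hc
    rw [Nat.succ_mul] at hcon
    set Δ := 2 * (e - 1) + c with hΔ
    obtain ⟨r, hr⟩ : ∃ r, (g.board b u).ncard = (g.board a u).ncard + (2 * e - 1) + r :=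
      Nat.exists_eq_add_of_le (by omega)
    have h1 := hi_growth g h0 u r a b hab hb
    have h2 := hi_le r (board_finite g h0 a (by omega) u)
    have h3 := ncard_le_hi r (board_finite g h0 b (by omega) u)
    have h4 : ((Finset.Ico a b).filter (Into g u r)).card =
        ((Finset.Ico a T).filter (Into g u r)).card +
        ((Finset.Ico T b).filter (Into g u r)).card := by
      rw [Finset.card_filter, Finset.card_filter, Finset.card_filter,
        Finset.sum_Ico_consecutive _ haT hTb]
    rcases (by omega : e ≤ ((Finset.Ico a T).filter (Into g u r)).card ∨
        e ≤ ((Finset.Ico T b).filter (Into g u r)).card) with h | h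
    · obtain ⟨t, v, h5, h6, h7, h8⟩ := sender g h0 s hs u r a T e he haT (by omega) h
      rw [hc0] at h7
      have := ih a t h5 (by omega) ((tcb_mono g le_rfl h6).trans hT1) v
      omega
    · obtain ⟨t, v, h5, h6, h7, h8⟩ := sender g h0 s hs u r T b e he hTb (by omega) h
      rw [hc0] at h7
      have := ih T t h5 (by omega) ((tcb_mono g le_rfl h6).trans hT2) v
      omega

theorem transfers_le (g : TokenGame n) (t : ℕ) (ht : t ≤ g.len) :
    transferCountBetween g 0 t ≤ n.choose 2 := by
  classical
  have hc := SimpleGraph.card_edgeFinset_top_eq_card_choose_two (V := Fin n)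
  rw [Fintype.card_fin] at hc
  rw [← hc]
  have hsome : ∀ x ∈ (Finset.Ico 0 t).filter fun t => (g.move t).isSome,
      x < g.len ∧ ∃ v i i', g.move x = some (v, i, i') := by
    intro x hx
    rw [Finset.mem_filter, Finset.mem_Ico] at hx
    refine ⟨by omega, ?_⟩
    obtain ⟨⟨v, i, i'⟩, h⟩ := Option.isSome_iff_exists.1 hx.2
    exact ⟨v, i, i', h⟩
  refine Finset.card_le_card_of_injOn
    (fun x => s(g.active x, ((g.move x).map Prod.fst).getD (g.active x))) ?_ ?_
  · intro x hx
    obtain ⟨hl, v, i, i', hm⟩ := hsome x hx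
    have := (g.step_some x hl v i i' hm).1
    simp [hm, this.symm]
  · have key : ∀ x y, x < y → y < g.len →
        (∃ v i i', g.move x = some (v, i, i')) → (∃ v i i', g.move y = some (v, i, i')) →
        s(g.active x, ((g.move x).map Prod.fst).getD (g.active x)) ≠
        s(g.active y, ((g.move y).map Prod.fst).getD (g.active y)) := by
      rintro x y hxy hl ⟨v, i, i', hm⟩ ⟨v', j, j', hm'⟩ heq
      obtain ⟨-, -, -, -, -, h, -⟩ := g.step_some y hl v' j j' hm'
      apply h x hxy v i i' hm
      simpa [hm, hm'] using heq
    intro x hx y hy heq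
    obtain ⟨hl, hm⟩ := hsome x hx
    obtain ⟨hl', hm'⟩ := hsome y hy
    by_contra hne
    rcases Nat.lt_or_gt_of_ne hne with h | h
    · exact key x y h hl' hm hm' heq
    · exact key y x h hl hm' hm heq.symm

theorem clog_bound (n : ℕ) (hn : 2 ≤ n) :
    (Nat.clog 2 (n.choose 2) : ℝ) ≤ 2 * Real.logb 2 n := by
  have hn' : (2:ℝ) ≤ n := by exact_mod_cast hn
  have hlog : 0 ≤ Real.logb 2 n := Real.logb_nonneg (by norm_num) (by linarith)
  rcases Nat.eq_zero_or_pos (Nat.clog 2 (n.choose 2)) with h | h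
  · rw [h]; simp; linarith
  · have h1 : 1 < n.choose 2 := by
      by_contra hc
      rw [Nat.clog_of_right_le_one (by omega)] at h
      omega
    have h2 := Nat.pow_pred_clog_lt_self (b := 2) (by norm_num) h1
    have h3 : (2:ℕ) ^ Nat.clog 2 (n.choose 2) ≤ n ^ 2 := by
      have h4 : 2 * n.choose 2 ≤ n ^ 2 := by
        rw [Nat.choose_two_right]
        have := Nat.mul_div_le (n * (n-1)) 2
        have h5 : n * (n - 1) ≤ n * n := Nat.mul_le_mul_left _ (by omega)
        nlinarith
      have h6 : (2:ℕ) ^ Nat.clog 2 (n.choose 2) = 2 * 2 ^ (Nat.clog 2 (n.choose 2)).pred := by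
        rw [← pow_succ', Nat.pred_eq_sub_one, Nat.sub_add_cancel h]
      omega
    have h7 : (2:ℝ) ^ Nat.clog 2 (n.choose 2) ≤ (n:ℝ) ^ 2 := by exact_mod_cast h3
    have h8 := Real.logb_le_logb_of_le (b := 2) (by norm_num) (by positivity) h7
    rw [Real.logb_pow, Real.logb_pow, Real.logb_self_eq_one (by norm_num)] at h8
    simpa using h8

theorem delta_bound (N : ℕ) (hN : 0 < N) :
    ∃ e : ℕ, 0 < e ∧ ((2 * (e - 1) + N / e : ℕ) : ℝ) ≤ 2 * Real.sqrt (2 * N) := by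
  have hN' : (0:ℝ) < N := by exact_mod_cast hN
  set q := Real.sqrt (2 * N) with hq
  have hq0 : 0 < q := Real.sqrt_pos.2 (by positivity)
  have hqq : q * q = 2 * N := Real.mul_self_sqrt (by positivity)
  have he : 0 < ⌈q / 2⌉₊ := Nat.ceil_pos.2 (by positivity)
  refine ⟨⌈q / 2⌉₊, he, ?_⟩
  have h1 : (⌈q / 2⌉₊ : ℝ) < q / 2 + 1 := Nat.ceil_lt_add_one (by positivity)
  have h2 : q / 2 ≤ (⌈q / 2⌉₊ : ℝ) := Nat.le_ceil _
  have h3 : ((N / ⌈q / 2⌉₊ : ℕ) : ℝ) ≤ q := by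
    refine Nat.cast_div_le.trans ?_
    rw [div_le_iff₀ (by exact_mod_cast he)]
    nlinarith
  push_cast [Nat.cast_sub (show 1 ≤ ⌈q / 2⌉₊ from he)]
  linarith

theorem member_bound (n s : ℕ) (hn : 2 ≤ n) (hs : 1 ≤ s) (g : TokenGame n)
    (h0 : ∀ u, (g.board 0 u).Finite) (hsu : ∀ u, (g.board 0 u).ncard ≤ s)
    (t : ℕ) (ht : t ≤ g.len) (u : Fin n) :
    ((g.board t u).ncard : ℝ) ≤
      4 * Real.logb 2 n * (Real.sqrt (2 * n * s) + 1) + s + 1 := by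
  obtain ⟨e, he, hd⟩ := delta_bound (n * s) (by positivity)
  have h1 := growth_bound g h0 s hsu e he _ rfl (Nat.clog 2 (n.choose 2)) 0 t (Nat.zero_le _) ht
    ((transfers_le g t ht).trans (Nat.le_pow_clog (by norm_num) _)) u
  have h2 := hsu u
  set Δ := 2 * (e - 1) + n * s / e
  have h3 : (g.board t u).ncard ≤ s + Nat.clog 2 (n.choose 2) * Δ + 1 := by omega
  have h4 : ((g.board t u).ncard : ℝ) ≤ s + Nat.clog 2 (n.choose 2) * Δ + 1 := by
    exact_mod_cast h3
  have h5 := clog_bound n hn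
  have hn' : (2:ℝ) ≤ n := by exact_mod_cast hn
  have hlog : 0 ≤ Real.logb 2 n := Real.logb_nonneg (by norm_num) (by linarith)
  have h6 := mul_le_mul h5 hd (Nat.cast_nonneg _) (by linarith)
  push_cast at h6
  rw [← mul_assoc (2:ℝ) (n:ℝ) (s:ℝ)] at h6
  nlinarith

/-- first bound of Corollary `tgbound` of the paper.
`ĝ(n,s) ≤ 4·lg n·(√(2ns) + 1) + s + 1` for `n ≥ 2` and `s ≥ 1`. -/
theorem ghat_upper_bound (n s : ℕ) (hn : 2 ≤ n) (hs : 1 ≤ s) :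
    (ghat n s : ℝ) ≤
      4 * Real.logb 2 n * (Real.sqrt (2 * n * s) + 1) + s + 1 := by
  have hX : 0 ≤ 4 * Real.logb 2 n * (Real.sqrt (2 * n * s) + 1) + s + 1 := by
    have hn' : (2:ℝ) ≤ n := by exact_mod_cast hn
    have hlog : 0 ≤ Real.logb 2 n := Real.logb_nonneg (by norm_num) (by linarith)
    positivity
  unfold ghat
  set S := {k | ∃ g : TokenGame n, (∀ u, (g.board 0 u).Finite) ∧
    (∀ u, (g.board 0 u).ncard ≤ s) ∧ ∃ t ≤ g.len, ∃ u, k = (g.board t u).ncard} with hS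
  have hb : ∀ k ∈ S, (k : ℝ) ≤
      4 * Real.logb 2 n * (Real.sqrt (2 * n * s) + 1) + s + 1 := by
    rintro k ⟨g, h0, hsu, t, ht, u, rfl⟩
    exact member_bound n s hn hs g h0 hsu t ht u
  rcases S.eq_empty_or_nonempty with h | h
  · rw [h]; simpa using hX
  · exact hb _ (Nat.sSup_mem h ⟨_, fun k hk => Nat.le_floor (hb k hk)⟩)

end AltitudePaper
end

section
/- Let G be an n-vertex graph, let s = n^{1/3}·(11·lg n)^{2/3} (lg the base-2 logarithm), and suppose n is sufficiently large that s ≤ n − 2. If G has average degree d = 2|E(G)|/n and d > 2, then f(G) > (d/(4s))·(1 − 2/d)·(1 − 1/s)·(1 − 4s²/(d − 2)). -/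
namespace AltitudePaper

variable {V : Type*}

section helpers
open Real


lemma tang {x y : ℝ} (hx : 0 ≤ x) (hy : 0 < y) :
    negMulLog x ≤ -x * log y + y - x := by
  rcases hx.eq_or_lt with rfl | hx
  · simp; exact hy.le
  · have h1 := Real.log_le_sub_one_of_pos (div_pos hy hx)
    rw [Real.log_div hy.ne' hx.ne'] at h1
    have h2 := mul_le_mul_of_nonneg_left h1 hx.le
    have h3 : x * (y / x - 1) = y - x := by field_simp
    unfold negMulLog
    nlinarith

lemma gain {a b δ : ℝ} (ha : 0 < a) (hb : 0 ≤ b) (hba : 4 * b ≤ a) (hδ : 0 ≤ δ)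
    (hδa : δ ≤ a / 4) :
    negMulLog a + negMulLog b + δ / 3 ≤ negMulLog (a - δ) + negMulLog (b + δ) := by
  rcases hδ.eq_or_lt with rfl | hδ
  · simp
  · have p1 : 0 < a - δ := by linarith
    have p2 : 0 < b + δ := by linarith
    have t1 := tang ha.le p1
    have t2 := tang hb p2
    have h1 := Real.one_sub_inv_le_log_of_pos (div_pos p1 p2)
    rw [Real.log_div p1.ne' p2.ne', inv_div] at h1
    have h2 : (b + δ) / (a - δ) ≤ 2 / 3 := by
      rw [div_le_iff₀ p1]; linarith
    have h3 : δ * (1 / 3) ≤ δ * (log (a - δ) - log (b + δ)) :=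
      mul_le_mul_of_nonneg_left (by linarith) hδ.le
    have e1 : negMulLog (a - δ) = -(a - δ) * log (a - δ) := rfl
    have e2 : negMulLog (b + δ) = -(b + δ) * log (b + δ) := rfl
    rw [e1, e2]
    nlinarith

lemma two_rows {ι : Type*} [Fintype ι] (a b : ι → ℝ)
    (ha : ∀ v, 0 ≤ a v) (hb : ∀ v, 0 ≤ b v) (sa : ∑ v, a v = 1) (sb : ∑ v, b v = 1)
    (RX RY : ι → Prop) (cX cY : ι → ℝ) (hcX : ∀ v, 0 ≤ cX v) (hcY : ∀ v, 0 ≤ cY v)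
    (h1 : ∀ v, 0 < a v → RY v ∨ 1 ≤ cX v) (h1' : ∀ v, 0 < b v → RX v ∨ 1 ≤ cY v)
    (h2 : ∀ v, 0 < a v → 0 < b v → 1 ≤ cX v ∨ 1 ≤ cY v) :
    ∃ (a' b' ia ib : ι → ℝ) (β : ℝ), 0 ≤ β ∧
      (∀ v, 0 ≤ a' v) ∧ (∀ v, 0 ≤ b' v) ∧ ∑ v, a' v = 1 ∧ ∑ v, b' v = 1 ∧
      (∀ v, 0 < a' v → 0 < a v ∨ RX v) ∧ (∀ v, 0 < b' v → 0 < b v ∨ RY v) ∧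
      (∀ v, 0 ≤ ia v) ∧ (∀ v, 0 ≤ ib v) ∧ (∀ v, a' v ≤ a v + ia v) ∧ (∀ v, b' v ≤ b v + ib v) ∧
      ∑ v, ia v = β / 4 ∧ ∑ v, ib v = β / 4 ∧
      (1 - β) / 4 ≤ ∑ v, (a v * cX v + b v * cY v) ∧
      ∑ v, (negMulLog (a v) + negMulLog (b v)) + β / 6 ≤
        ∑ v, (negMulLog (a' v) + negMulLog (b' v)) := by
  classical
  set Tx : ι → Prop := fun v => 0 < a v ∧ 4 * b v ≤ a v ∧ RY v with hTx
  set Ty : ι → Prop := fun v => 0 < b v ∧ 4 * a v ≤ b v ∧ RX v with hTy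
  set ta : ι → ℝ := fun v => if Tx v then a v else 0 with hta
  set tb : ι → ℝ := fun v => if Ty v then b v else 0 with htb
  have ta0 : ∀ v, 0 ≤ ta v := fun v => by simp only [hta]; split_ifs; exacts [ha v, le_rfl]
  have tb0 : ∀ v, 0 ≤ tb v := fun v => by simp only [htb]; split_ifs; exacts [hb v, le_rfl]
  set X := ∑ v, ta v with hX
  set Y := ∑ v, tb v with hY
  have X0 : 0 ≤ X := Finset.sum_nonneg fun v _ => ta0 v
  have Y0 : 0 ≤ Y := Finset.sum_nonneg fun v _ => tb0 v
  set β := min X Y with hβ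
  have β0 : 0 ≤ β := le_min X0 Y0
  have frac : ∀ Z : ℝ, 0 ≤ Z → β ≤ Z → 0 ≤ β / (4 * Z) ∧ β / (4 * Z) ≤ 1 / 4 ∧
      β / (4 * Z) * Z = β / 4 := by
    intro Z hZ hbz
    rcases hZ.eq_or_lt with rfl | hZ
    · have : β = 0 := le_antisymm hbz β0
      simp [this]
    · refine ⟨by positivity, ?_, by field_simp⟩
      rw [div_le_iff₀ (by positivity)]; linarith
  obtain ⟨lx0, lx1, lx2⟩ := frac X X0 (min_le_left _ _)
  obtain ⟨ly0, ly1, ly2⟩ := frac Y Y0 (min_le_right _ _)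
  set lx := β / (4 * X)
  set ly := β / (4 * Y)
  have s1 : ∑ v, lx * ta v = β / 4 := by rw [← Finset.mul_sum, lx2]
  have s2 : ∑ v, ly * tb v = β / 4 := by rw [← Finset.mul_sum, ly2]
  have tale : ∀ v, ta v ≤ a v := fun v => by
    simp only [hta]; split_ifs; exacts [le_rfl, ha v]
  have tble : ∀ v, tb v ≤ b v := fun v => by
    simp only [htb]; split_ifs; exacts [le_rfl, hb v]
  have cst : (1 - β) / 4 ≤ ∑ v, (a v * cX v + b v * cY v) := by
    have hx : (1 - X) / 4 ≤ ∑ v, (a v * cX v + b v * cY v) := by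
      rw [hX, ← sa, ← Finset.sum_sub_distrib, Finset.sum_div]
      refine Finset.sum_le_sum fun v _ => ?_
      have q1 := mul_nonneg (ha v) (hcX v)
      have q2 := mul_nonneg (hb v) (hcY v)
      have q3 := ha v
      have q4 := hb v
      simp only [hta]
      split_ifs with hT
      · linarith
      · rcases (ha v).eq_or_lt with h | h
        · linarith
        rcases h1 v h with hr | hc
        · have hb' : a v < 4 * b v := by
            by_contra hh
            exact hT ⟨h, not_lt.1 hh, hr⟩
          rcases h2 v h (by linarith) with hc | hc
          · nlinarith
          · nlinarith
        · nlinarith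
    have hy : (1 - Y) / 4 ≤ ∑ v, (a v * cX v + b v * cY v) := by
      rw [hY, ← sb, ← Finset.sum_sub_distrib, Finset.sum_div]
      refine Finset.sum_le_sum fun v _ => ?_
      have q1 := mul_nonneg (ha v) (hcX v)
      have q2 := mul_nonneg (hb v) (hcY v)
      have q3 := ha v
      have q4 := hb v
      simp only [htb]
      split_ifs with hT
      · linarith
      · rcases (hb v).eq_or_lt with h | h
        · linarith
        rcases h1' v h with hr | hc
        · have hb' : b v < 4 * a v := by
            by_contra hh
            exact hT ⟨h, not_lt.1 hh, hr⟩
          rcases h2 v (by linarith) h with hc | hc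
          · nlinarith
          · nlinarith
        · nlinarith
    rcases min_choice X Y with h | h
    · rw [hβ, h]; exact hx
    · rw [hβ, h]; exact hy
  refine ⟨fun v => a v - lx * ta v + ly * tb v, fun v => b v - ly * tb v + lx * ta v,
    fun v => ly * tb v, fun v => lx * ta v, β, β0, ?_, ?_, ?_, ?_, ?_, ?_, ?_, ?_, ?_, ?_, s2, s1,
    cst, ?_⟩
  · intro v
    have := mul_nonneg ly0 (tb0 v)
    have := tale v
    have := ta0 v
    simp only
    nlinarith
  · intro v
    have := mul_nonneg lx0 (ta0 v)
    have := tble v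
    have := tb0 v
    simp only
    nlinarith
  · simp only [Finset.sum_add_distrib, Finset.sum_sub_distrib, s1, s2, sa]; ring
  · simp only [Finset.sum_add_distrib, Finset.sum_sub_distrib, s1, s2, sb]; ring
  · intro v hv
    by_cases hT : Ty v
    · exact Or.inr hT.2.2
    · left
      simp only [htb, if_neg hT] at hv
      have := mul_nonneg lx0 (ta0 v)
      linarith
  · intro v hv
    by_cases hT : Tx v
    · exact Or.inr hT.2.2
    · left
      simp only [hta, if_neg hT] at hv
      have := mul_nonneg ly0 (tb0 v)
      linarith
  · exact fun v => mul_nonneg ly0 (tb0 v)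
  · exact fun v => mul_nonneg lx0 (ta0 v)
  · intro v
    have := mul_nonneg lx0 (ta0 v)
    simp only; linarith
  · intro v
    have := mul_nonneg ly0 (tb0 v)
    simp only; linarith
  · have e : β / 6 = ∑ v, (lx * ta v / 3 + ly * tb v / 3) := by
      rw [Finset.sum_add_distrib, ← Finset.sum_div, ← Finset.sum_div, s1, s2]; ring
    rw [e, ← Finset.sum_add_distrib]
    refine Finset.sum_le_sum fun v _ => ?_
    by_cases hx : Tx v
    · have hy : ¬ Ty v := by
        rintro ⟨y1, y2, y3⟩
        obtain ⟨x1, x2, x3⟩ := hx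
        linarith
      have g := gain hx.1 (hb v) hx.2.1 (mul_nonneg lx0 (ha v)) (by nlinarith [ha v])
      simp only [hta, htb, if_pos hx, if_neg hy]
      simp only [mul_zero, add_zero, sub_zero, zero_div]
      linarith
    · by_cases hy : Ty v
      · have g := gain hy.1 (ha v) hy.2.1 (mul_nonneg ly0 (hb v)) (by nlinarith [hb v])
        simp only [hta, htb, if_pos hy, if_neg hx]
        simp only [mul_zero, add_zero, sub_zero, zero_div]
        linarith
      · simp only [hta, htb, if_neg hy, if_neg hx]
        simp

lemma sum_two {V : Type*} [Fintype V] [DecidableEq V] (f g : V → ℝ) (x y : V) (hxy : x ≠ y)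
    (c : ℝ) (h : ∀ z, z ≠ x → z ≠ y → f z ≤ g z) (hc : f x + f y + c ≤ g x + g y) :
    ∑ z, f z + c ≤ ∑ z, g z := by
  have key : ∀ q : V → ℝ, ∑ z, q z = q x + q y + ∑ z ∈ (Finset.univ.erase x).erase y, q z := by
    intro q
    rw [← Finset.add_sum_erase Finset.univ q (Finset.mem_univ x),
      ← Finset.add_sum_erase (Finset.univ.erase x) q (a := y) (by simp [hxy.symm])]
    ring
  rw [key f, key g]
  have : ∑ z ∈ (Finset.univ.erase x).erase y, f z ≤ ∑ z ∈ (Finset.univ.erase x).erase y, g z := by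
    refine Finset.sum_le_sum fun z hz => ?_
    simp only [Finset.mem_erase] at hz
    exact h z hz.2.1 hz.1
  linarith

lemma ent_le {ι : Type*} [Fintype ι] [Nonempty ι] (a : ι → ℝ) (ha : ∀ v, 0 ≤ a v)
    (sa : ∑ v, a v = 1) : ∑ v, negMulLog (a v) ≤ log (Fintype.card ι) := by
  have hn : (0 : ℝ) < Fintype.card ι := by exact_mod_cast Fintype.card_pos
  have h : ∀ v, negMulLog (a v) ≤ a v * log (Fintype.card ι) + 1 / (Fintype.card ι : ℝ) - a v := by
    intro v
    have := tang (ha v) (y := 1 / (Fintype.card ι : ℝ)) (by positivity)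
    rw [one_div, Real.log_inv] at this
    rw [one_div]
    linarith
  refine (Finset.sum_le_sum fun v _ => h v).trans ?_
  rw [Finset.sum_sub_distrib, Finset.sum_add_distrib, ← Finset.sum_mul, sa]
  simp

open Classical in
lemma weight_lemma {V : Type*} [Fintype V] [Nonempty V] (N Q : ℕ) (x y : ℕ → V)
    (hxy : ∀ i < N, x i ≠ y i) (R ch : ℕ → V → V → Prop)
    (h0 : ∀ v, R 0 v v) (hmono : ∀ i z v, R i z v → R (i + 1) z v)
    (h1 : ∀ i < N, ∀ v, R i (x i) v → R (i + 1) (y i) v ∨ ch i (x i) v)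
    (h1' : ∀ i < N, ∀ v, R i (y i) v → R (i + 1) (x i) v ∨ ch i (y i) v)
    (h2 : ∀ i < N, ∀ v, R i (x i) v → R i (y i) v → ch i (x i) v ∨ ch i (y i) v)
    (h3 : ∀ z v, ((Finset.range N).filter (fun i => ch i z v)).card ≤ Q) :
    (N : ℝ) ≤ Fintype.card V * (4 * Q + (12 * Q + 6) * log (Fintype.card V)) := by
  set rem : ℕ → V → V → ℝ := fun i z v =>
    (Q : ℝ) - ((Finset.range i).filter (fun i => ch i z v)).card with hrem
  have rem_le : ∀ i z v, rem i z v ≤ Q := fun i z v => by simp [hrem]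
  have rem_nn : ∀ i ≤ N, ∀ z v, 0 ≤ rem i z v := by
    intro i hi z v
    have : ((Finset.range i).filter (fun i => ch i z v)).card ≤ Q :=
      (Finset.card_le_card (Finset.filter_subset_filter _ (Finset.range_mono hi))).trans (h3 z v)
    simp only [hrem, sub_nonneg]
    exact_mod_cast this
  have rem_succ : ∀ i z v, rem (i + 1) z v = rem i z v - if ch i z v then 1 else 0 := by
    intro i z v
    simp only [hrem, Finset.range_add_one, Finset.filter_insert]
    split_ifs with h
    · rw [Finset.card_insert_of_notMem (by simp)]
      push_cast; ring
    · ring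
  set A : ℝ := 3 * Q + 3 / 2 with hA
  have hA0 : 0 ≤ A := by positivity
  set n := Fintype.card V with hn
  have main : ∀ i ≤ N, ∃ m : V → V → ℝ, (∀ z v, 0 ≤ m z v) ∧ (∀ z, ∑ v, m z v = 1) ∧
      (∀ z v, 0 < m z v → R i z v) ∧
      ∑ z, ∑ v, (m z v * rem i z v - A * negMulLog (m z v)) + (i : ℝ) / 4 ≤ n * Q := by
    intro i
    induction i with
    | zero =>
      intro _
      refine ⟨fun z v => if z = v then 1 else 0, ?_, ?_, ?_, ?_⟩
      · intro z v; dsimp only; split_ifs <;> norm_num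
      · intro z; simp
      · intro z v h
        dsimp only at h
        split_ifs at h with hz
        · subst hz; exact h0 z
        · exact absurd h (lt_irrefl _)
      · have : ∀ z v : V, ((if z = v then (1:ℝ) else 0) * rem 0 z v -
            A * negMulLog (if z = v then (1:ℝ) else 0)) = if z = v then (Q : ℝ) else 0 := by
          intro z v
          split_ifs <;> simp [hrem]
        simp only [this]
        simp [hn]
    | succ i ih =>
      intro hi
      obtain ⟨m, m0, ms, mR, mb⟩ := ih (by omega)
      have hi' : i < N := by omega
      have hne := hxy i hi'
      set cX : V → ℝ := fun v => if ch i (x i) v then 1 else 0 with hcX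
      set cY : V → ℝ := fun v => if ch i (y i) v then 1 else 0 with hcY
      have cX0 : ∀ v, 0 ≤ cX v := fun v => by simp only [hcX]; split_ifs <;> norm_num
      have cY0 : ∀ v, 0 ≤ cY v := fun v => by simp only [hcY]; split_ifs <;> norm_num
      have oneX : ∀ v, ch i (x i) v → 1 ≤ cX v := fun v h => by simp [hcX, h]
      have oneY : ∀ v, ch i (y i) v → 1 ≤ cY v := fun v h => by simp [hcY, h]
      obtain ⟨a', b', ia, ib, β, β0, a0, b0, sa, sb, ra, rb, ia0, ib0, la, lb, sia, sib, cst, ent⟩ :=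
        two_rows (m (x i)) (m (y i)) (m0 _) (m0 _) (ms _) (ms _)
          (fun v => R (i+1) (x i) v) (fun v => R (i+1) (y i) v) cX cY cX0 cY0
          (fun v hv => (h1 i hi' v (mR _ _ hv)).imp id (oneX v))
          (fun v hv => (h1' i hi' v (mR _ _ hv)).imp id (oneY v))
          (fun v hv hv' => (h2 i hi' v (mR _ _ hv) (mR _ _ hv')).imp (oneX v) (oneY v))
      set m' : V → V → ℝ := fun z => if z = x i then a' else if z = y i then b' else m z with hm'
      have mx : m' (x i) = a' := by simp [hm']
      have my : m' (y i) = b' := by simp [hm', hne.symm]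
      have mo : ∀ z, z ≠ x i → z ≠ y i → m' z = m z := fun z h h' => by simp [hm', h, h']
      have cases3 : ∀ (p : V → Prop), p (x i) → p (y i) → (∀ z, z ≠ x i → z ≠ y i → p z) →
          ∀ z, p z := by
        intro p px py pz z
        by_cases hz : z = x i
        · exact hz ▸ px
        · by_cases hz' : z = y i
          · exact hz' ▸ py
          · exact pz z hz hz'
      refine ⟨m', ?_, ?_, ?_, ?_⟩
      · refine cases3 _ ?_ ?_ ?_
        · rw [mx]; exact a0
        · rw [my]; exact b0
        · intro z h h'; rw [mo z h h']; exact m0 z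
      · refine cases3 _ ?_ ?_ ?_
        · rw [mx]; exact sa
        · rw [my]; exact sb
        · intro z h h'; rw [mo z h h']; exact ms z
      · refine cases3 _ ?_ ?_ ?_
        · rw [mx]; intro v hv
          exact (ra v hv).elim (fun h => hmono _ _ _ (mR _ _ h)) id
        · rw [my]; intro v hv
          exact (rb v hv).elim (fun h => hmono _ _ _ (mR _ _ h)) id
        · intro z h h'; rw [mo z h h']; exact fun v hv => hmono _ _ _ (mR _ _ hv)
      · refine le_trans ?_ mb
        have := sum_two (fun z => ∑ v, (m' z v * rem (i+1) z v - A * negMulLog (m' z v)))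
          (fun z => ∑ v, (m z v * rem i z v - A * negMulLog (m z v))) (x i) (y i) hne (1/4) ?_ ?_
        · push_cast; linarith
        · intro z h h'
          rw [mo z h h']
          refine Finset.sum_le_sum fun v _ => ?_
          have : rem (i+1) z v ≤ rem i z v := by
            rw [rem_succ]; split_ifs <;> linarith
          have := mul_le_mul_of_nonneg_left this (m0 z v)
          linarith
        · rw [mx, my, ← Finset.sum_add_distrib, ← Finset.sum_add_distrib]
          have pt : ∀ v, a' v * rem (i+1) (x i) v - A * negMulLog (a' v) +
              (b' v * rem (i+1) (y i) v - A * negMulLog (b' v)) ≤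
              (m (x i) v * rem i (x i) v - A * negMulLog (m (x i) v) +
              (m (y i) v * rem i (y i) v - A * negMulLog (m (y i) v))) +
              (A * (negMulLog (m (x i) v) + negMulLog (m (y i) v)) -
                A * (negMulLog (a' v) + negMulLog (b' v)) + Q * ia v + Q * ib v -
                (m (x i) v * cX v + m (y i) v * cY v)) := by
            intro v
            have u1 := mul_le_mul_of_nonneg_right (la v) (rem_nn (i+1) hi (x i) v)
            have u2 := mul_le_mul_of_nonneg_right (lb v) (rem_nn (i+1) hi (y i) v)
            have u3 := mul_le_mul_of_nonneg_right (rem_le (i+1) (x i) v) (ia0 v)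
            have u4 := mul_le_mul_of_nonneg_right (rem_le (i+1) (y i) v) (ib0 v)
            have e1 : rem (i+1) (x i) v = rem i (x i) v - cX v := rem_succ _ _ _
            have e2 : rem (i+1) (y i) v = rem i (y i) v - cY v := rem_succ _ _ _
            rw [e1] at u1 u3 ⊢
            rw [e2] at u2 u4 ⊢
            linarith
          have S := Finset.sum_le_sum (s := Finset.univ) fun v _ => pt v
          rw [Finset.sum_add_distrib (g := fun v => (A * (negMulLog (m (x i) v) + negMulLog (m (y i) v)) -
                A * (negMulLog (a' v) + negMulLog (b' v)) + Q * ia v + Q * ib v -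
                (m (x i) v * cX v + m (y i) v * cY v)))] at S
          have E : ∑ v, (A * (negMulLog (m (x i) v) + negMulLog (m (y i) v)) -
                A * (negMulLog (a' v) + negMulLog (b' v)) + Q * ia v + Q * ib v -
                (m (x i) v * cX v + m (y i) v * cY v)) ≤ -(1/4) := by
            rw [Finset.sum_sub_distrib, Finset.sum_add_distrib, Finset.sum_add_distrib,
              Finset.sum_sub_distrib, ← Finset.mul_sum, ← Finset.mul_sum, ← Finset.mul_sum,
              ← Finset.mul_sum, sia, sib]
            have := mul_le_mul_of_nonneg_left ent hA0
            have e3 : A * (β / 6) = Q * β / 2 + β / 4 := by rw [hA]; ring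
            linarith
          linarith
  obtain ⟨m, m0, ms, mR, mb⟩ := main N le_rfl
  have lower : -(A * (n * log n)) ≤
      ∑ z, ∑ v, (m z v * rem N z v - A * negMulLog (m z v)) := by
    have : ∀ z, -(A * log n) ≤ ∑ v, (m z v * rem N z v - A * negMulLog (m z v)) := by
      intro z
      rw [Finset.sum_sub_distrib, ← Finset.mul_sum]
      have q1 : 0 ≤ ∑ v, m z v * rem N z v :=
        Finset.sum_nonneg fun v _ => mul_nonneg (m0 z v) (rem_nn N le_rfl z v)
      have q2 := mul_le_mul_of_nonneg_left (ent_le (m z) (m0 z) (ms z)) hA0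
      linarith
    have := Finset.sum_le_sum (s := Finset.univ) fun z _ => this z
    simp only [Finset.sum_const, Finset.card_univ, nsmul_eq_mul] at this
    linarith
  have e4 : A * (n * log n) = (3 * Q + 3 / 2) * (n * log n) := rfl
  nlinarith


open Classical in
noncomputable def upd {V : Type*} (x : V) (px py : Option (List V)) : Option (List V) :=
  match py with
  | none => px
  | some q => if x ∈ q then px else match px with
    | none => some (x :: q)
    | some q' => if q'.length ≤ q.length then some (x :: q) else px

open Classical in
noncomputable def st {V : Type*} (x y : ℕ → V) (v : V) (P0 : List V) : ℕ → V → Option (List V)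
  | 0 => fun z => if z = v then some P0 else none
  | i+1 => fun z => if z = x i then upd z (st x y v P0 i (x i)) (st x y v P0 i (y i))
      else if z = y i then upd z (st x y v P0 i (y i)) (st x y v P0 i (x i))
      else st x y v P0 i z

lemma upd_cases {V : Type*} (x : V) (px py : Option (List V)) :
    upd x px py = px ∨ ∃ q, py = some q ∧ x ∉ q ∧ upd x px py = some (x :: q) ∧
      ∀ q', px = some q' → q'.length ≤ q.length := by
  unfold upd
  rcases py with _ | q
  · simp
  · rcases px with _ | q'
    · by_cases h : x ∈ q <;> simp [h]
    · by_cases h : x ∈ q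
      · simp [h]
      · by_cases h' : q'.length ≤ q.length <;> simp [h, h']

lemma upd_some {V : Type*} (x : V) (px : Option (List V)) (q : List V) :
    (x ∈ q) ∨ (upd x px (some q)).isSome := by
  unfold upd
  by_cases h : x ∈ q
  · simp [h]
  · rcases px with _ | q'
    · simp [h]
    · by_cases h' : q'.length ≤ q.length <;> simp [h, h']

lemma upd_ne {V : Type*} (x : V) (q' q : List V) (h : x ∉ q) (h' : q'.length ≤ q.length) :
    upd x (some q') (some q) ≠ some q' := by
  unfold upd
  simp only [h, h', if_true, if_false]
  intro e
  have := congrArg List.length (Option.some.inj e)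
  simp at this; omega

section
variable {V : Type*} (x y : ℕ → V) (v : V) (P0 : List V)

lemma st_x (i : ℕ) : st x y v P0 (i+1) (x i) = upd (x i) (st x y v P0 i (x i)) (st x y v P0 i (y i)) := by
  simp [st]

lemma st_y (i : ℕ) (h : x i ≠ y i) :
    st x y v P0 (i+1) (y i) = upd (y i) (st x y v P0 i (y i)) (st x y v P0 i (x i)) := by
  simp [st, h.symm]

lemma st_o (i : ℕ) (z : V) (h : z ≠ x i) (h' : z ≠ y i) :
    st x y v P0 (i+1) z = st x y v P0 i z := by
  simp [st, h, h']

lemma st_step (i : ℕ) (z : V) (hne : x i ≠ y i) :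
    st x y v P0 (i+1) z = st x y v P0 i z ∨ ∃ q w, s(z, w) = s(x i, y i) ∧
      st x y v P0 i w = some q ∧ z ∉ q ∧ st x y v P0 (i+1) z = some (z :: q) ∧
      ∀ q', st x y v P0 i z = some q' → q'.length ≤ q.length := by
  by_cases h : z = x i
  · subst h
    rw [st_x]
    rcases upd_cases (x i) (st x y v P0 i (x i)) (st x y v P0 i (y i)) with h | ⟨q, h1, h2, h3, h4⟩
    · left; exact h
    · right; exact ⟨q, y i, rfl, h1, h2, h3, h4⟩
  · by_cases h' : z = y i
    · subst h'
      rw [st_y _ _ _ _ _ hne]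
      rcases upd_cases (y i) (st x y v P0 i (y i)) (st x y v P0 i (x i)) with h | ⟨q, h1, h2, h3, h4⟩
      · left; exact h
      · right; exact ⟨q, x i, Sym2.eq_swap, h1, h2, h3, h4⟩
    · left; exact st_o _ _ _ _ _ _ h h'

lemma st_inv (N : ℕ) (hxy : ∀ i < N, x i ≠ y i) (I : ℕ → V → List V → Prop)
    (I0 : I 0 v P0) (Is : ∀ i z q, I i z q → I (i+1) z q)
    (I1 : ∀ i < N, ∀ z w q, s(z, w) = s(x i, y i) → I i w q → z ∉ q →
      st x y v P0 i w = some q → I (i+1) z (z :: q)) :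
    ∀ i ≤ N, ∀ z q, st x y v P0 i z = some q → I i z q := by
  intro i
  induction i with
  | zero =>
    intro _ z q h
    simp only [st] at h
    split_ifs at h with h'
    · subst h'; rw [← Option.some.inj h]; exact I0
  | succ i ih =>
    intro hi z q h
    rcases st_step x y v P0 i z (hxy i (by omega)) with h' | ⟨q', w, h1, h2, h3, h4, h5⟩
    · exact Is _ _ _ (ih (by omega) z q (h' ▸ h))
    · rw [h4] at h
      rw [← Option.some.inj h]
      exact I1 i (by omega) z w q' h1 (ih (by omega) w q' h2) h3 h2

def chg (i : ℕ) (z : V) : Prop :=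
  ∃ w, s(z, w) = s(x i, y i) ∧ ∃ q, st x y v P0 i z = some q ∧
    (w ∈ q ∨ st x y v P0 (i+1) z ≠ st x y v P0 i z)

open Classical in
lemma chg_card (N k : ℕ) (hxy : ∀ i < N, x i ≠ y i)
    (hinj : ∀ i < N, ∀ j < N, s(x i, y i) = s(x j, y j) → i = j)
    (H : ∀ i < N, ∀ z ∈ s(x i, y i), ∀ q, st x y v P0 i z = some q → q.length < P0.length + k)
    (z : V) : ((Finset.range N).filter (fun i => chg x y v P0 i z)).card ≤ P0.length + k * k + k := by
  have suf : ∀ i ≤ N, ∀ z q, st x y v P0 i z = some q → ∃ t, q = t ++ P0 :=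
    st_inv x y v P0 N hxy (fun _ _ q => ∃ t, q = t ++ P0) ⟨[], rfl⟩ (fun _ _ _ h => h)
      (by rintro i _ z w q _ ⟨t, rfl⟩ _ _; exact ⟨z :: t, rfl⟩)
  set r := fun i => st x y v P0 i z with hr
  let T1 : ℕ → Prop := fun i => ∃ w, s(z, w) = s(x i, y i) ∧ ∃ q, r i = some q ∧ w ∈ q
  let T2 : ℕ → Prop := fun i => (∃ q, r i = some q) ∧ r (i+1) ≠ r i
  have key : ∀ i ≤ N, ∃ (S : Finset V) (l : ℕ), P0.toFinset ⊆ S ∧ l ≤ k ∧ S.card ≤ P0.length + k * l ∧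
      ((Finset.range i).filter T2).card ≤ l ∧
      (∀ i' < i, ∀ w, s(z, w) = s(x i', y i') → ∀ q, r i' = some q → w ∈ q → w ∈ S) ∧
      (∀ q, r i = some q → q.toFinset ⊆ S ∧ q.length = P0.length + l) ∧ (r i = none → l = 0) := by
    intro i
    induction i with
    | zero =>
      intro _
      refine ⟨P0.toFinset, 0, subset_rfl, by omega, ?_, by simp, by simp, ?_, by simp⟩
      · simpa using List.toFinset_card_le P0
      · intro q h
        simp only [hr, st] at h
        split_ifs at h with h'
        rw [← Option.some.inj h]; simp
    | succ i ih =>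
      intro hi
      obtain ⟨S, l, a1, a2, a3, a4, a5, a6, a7⟩ := ih (by omega)
      have a5' : ∀ i' < i+1, ∀ w, s(z, w) = s(x i', y i') → ∀ q, r i' = some q → w ∈ q → w ∈ S := by
        intro i' hi' w hw q hq hwq
        rcases Nat.lt_succ_iff_lt_or_eq.1 hi' with h | rfl
        · exact a5 i' h w hw q hq hwq
        · exact (a6 q hq).1 (by simpa using hwq)
      rcases st_step x y v P0 i z (hxy i (by omega)) with h' | ⟨q', w, h1, h2, h3, h4, h5⟩
      · have h'' : r (i+1) = r i := h'
        refine ⟨S, l, a1, a2, a3, ?_, a5', by rw [h'']; exact a6, by rw [h'']; exact a7⟩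
        rw [Finset.range_add_one, Finset.filter_insert, if_neg]
        · exact a4
        · intro h; exact h.2 h''
      · have h4' : r (i+1) = some (z :: q') := h4
        obtain ⟨t, ht⟩ := suf i (by omega) w q' h2
        have hlen := H i (by omega) w (by rw [← h1]; simp) q' h2
        have hl : q'.length = t.length + P0.length := by rw [ht]; simp
        have lt : l < t.length + 1 := by
          rcases hri : r i with _ | q0
          · rw [a7 hri]; omega
          · have := (a6 q0 hri).2
            have := h5 q0 hri
            omega
        refine ⟨S ∪ (z :: t).toFinset, t.length + 1, a1.trans Finset.subset_union_left, by omega, ?_, ?_, ?_, ?_, ?_⟩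
        · have := Finset.card_union_le S (z :: t).toFinset
          have := List.toFinset_card_le (z :: t)
          simp only [List.length_cons] at this
          obtain ⟨m, hm⟩ : ∃ m, t.length + 1 = l + m + 1 := ⟨t.length - l, by omega⟩
          rw [hm] at this ⊢
          have : k * (l + m + 1) = k * l + k * m + k := by ring
          have : t.length + 1 ≤ k := by omega
          omega
        · rw [Finset.range_add_one, Finset.filter_insert]
          split_ifs
          · have := Finset.card_insert_le i ((Finset.range i).filter T2)
            omega
          · omega
        · intro i' hi' w hw q hq hwq
          exact Finset.mem_union_left _ (a5' i' hi' w hw q hq hwq)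
        · intro q hq
          rw [h4'] at hq
          rw [← Option.some.inj hq]
          constructor
          · intro a ha
            rw [ht] at ha
            simp only [List.mem_toFinset, List.mem_cons, List.mem_append, Finset.mem_union] at ha ⊢
            rcases ha with h | h | h
            · exact Or.inr (Or.inl h)
            · exact Or.inr (Or.inr h)
            · exact Or.inl (a1 (by simpa using h))
          · simp; omega
        · intro h; rw [h4'] at h; simp at h
  obtain ⟨S, l, a1, a2, a3, a4, a5, a6, a7⟩ := key N le_rfl
  have sub : (Finset.range N).filter (fun i => chg x y v P0 i z) ⊆
      (Finset.range N).filter T1 ∪ (Finset.range N).filter T2 := by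
    intro i hi
    rw [Finset.mem_filter] at hi
    obtain ⟨hi, w, hw, q, hq, h⟩ := hi
    rw [Finset.mem_union, Finset.mem_filter, Finset.mem_filter]
    rcases h with h | h
    · exact Or.inl ⟨hi, w, hw, q, hq, h⟩
    · exact Or.inr ⟨hi, ⟨q, hq⟩, h⟩
  have c1 : ((Finset.range N).filter T1).card ≤ S.card := by
    have hT : ∀ i ∈ (Finset.range N).filter T1, ∃ w, s(z, w) = s(x i, y i) ∧ w ∈ S := by
      intro i hi
      rw [Finset.mem_filter, Finset.mem_range] at hi
      obtain ⟨hi, w, hw, q, hq, h⟩ := hi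
      exact ⟨w, hw, a5 i hi w hw q hq h⟩
    have : Nonempty V := ⟨z⟩
    choose! g hg1 hg2 using hT
    refine Finset.card_le_card_of_injOn g hg2 ?_
    intro i hi j hj hij
    have e := hg1 i hi
    rw [hij, hg1 j hj] at e
    have hi' := (Finset.mem_filter.1 hi).1
    have hj' := (Finset.mem_filter.1 hj).1
    rw [Finset.mem_range] at hi' hj'
    exact hinj i hi' j hj' e.symm
  have := Finset.card_le_card sub
  have := Finset.card_union_le ((Finset.range N).filter T1) ((Finset.range N).filter T2)
  have : k * l ≤ k * k := Nat.mul_le_mul_left _ a2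
  omega

end

/-- Combination of the weight lemma with the list process. -/
lemma process_lemma {V : Type*} [Fintype V] [Nonempty V] (N k Q : ℕ) (x y : ℕ → V)
    (hxy : ∀ i < N, x i ≠ y i)
    (hinj : ∀ i < N, ∀ j < N, s(x i, y i) = s(x j, y j) → i = j)
    (P : V → List V) (hQ : ∀ v, (P v).length + k * k + k ≤ Q)
    (H : ∀ v, ∀ i < N, ∀ z ∈ s(x i, y i), ∀ q, st x y v (P v) i z = some q →
      q.length < (P v).length + k) :
    (N : ℝ) ≤ Fintype.card V * (4 * Q + (12 * Q + 6) * log (Fintype.card V)) := by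
  have mono : ∀ i, i < N → ∀ z v, (st x y v (P v) i z).isSome → (st x y v (P v) (i+1) z).isSome := by
    intro i hi z v h
    rcases st_step x y v (P v) i z (hxy i hi) with h' | ⟨q', w, h1, h2, h3, h4, h5⟩
    · rw [h']; exact h
    · rw [h4]; rfl
  refine weight_lemma N Q x y hxy (fun i z v => (st x y v (P v) (min i N) z).isSome)
    (fun i z v => chg x y v (P v) i z) ?_ ?_ ?_ ?_ ?_ ?_
  · intro v; simp [st]
  · intro i z v h
    by_cases hi : i < N
    · have e1 : min i N = i := by omega
      have e2 : min (i+1) N = i+1 := by omega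
      simp only [e1, e2] at h ⊢
      exact mono i hi z v h
    · have e1 : min i N = N := by omega
      have e2 : min (i+1) N = N := by omega
      simp only [e1, e2] at h ⊢
      exact h
  · intro i hi v h
    have e1 : min i N = i := by omega
    have e2 : min (i+1) N = i+1 := by omega
    simp only [e1, e2] at h ⊢
    obtain ⟨q, hq⟩ := Option.isSome_iff_exists.1 h
    rw [st_y _ _ _ _ _ (hxy i hi), hq]
    rcases upd_some (y i) (st x y v (P v) i (y i)) q with h | h
    · right; exact ⟨y i, rfl, q, hq, Or.inl h⟩
    · left; exact h
  · intro i hi v h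
    have e1 : min i N = i := by omega
    have e2 : min (i+1) N = i+1 := by omega
    simp only [e1, e2] at h ⊢
    obtain ⟨q, hq⟩ := Option.isSome_iff_exists.1 h
    rw [st_x, hq]
    rcases upd_some (x i) (st x y v (P v) i (x i)) q with h | h
    · right; exact ⟨x i, Sym2.eq_swap, q, hq, Or.inl h⟩
    · left; exact h
  · intro i hi v h h'
    have e1 : min i N = i := by omega
    simp only [e1] at h h' ⊢
    obtain ⟨q, hq⟩ := Option.isSome_iff_exists.1 h
    obtain ⟨q', hq'⟩ := Option.isSome_iff_exists.1 h'
    rcases le_total q.length q'.length with hl | hl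
    · by_cases hm : x i ∈ q'
      · right; exact ⟨x i, Sym2.eq_swap, q', hq', Or.inl hm⟩
      · left; refine ⟨y i, rfl, q, hq, Or.inr ?_⟩
        rw [st_x, hq, hq']; exact upd_ne _ _ _ hm hl
    · by_cases hm : y i ∈ q
      · left; exact ⟨y i, rfl, q, hq, Or.inl hm⟩
      · right; refine ⟨x i, Sym2.eq_swap, q', hq', Or.inr ?_⟩
        rw [st_y _ _ _ _ _ (hxy i hi), hq, hq']; exact upd_ne _ _ _ hm hl
  · intro z v
    exact (chg_card x y v (P v) N k hxy hinj (H v) z).trans (hQ v)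


section graph

local instance (priority := high) ordInst {V : Type*} [oe : LinearOrder (Sym2 V)] :
    PartialOrder (Sym2 V) := oe.toPartialOrder

variable {V : Type*} (G : SimpleGraph V) [oe : LinearOrder (Sym2 V)]

/-- `q` is the support of a monotone path from `z` all of whose edges are above `e`. -/
def MP (e : Sym2 V) (z : V) (q : List V) : Prop :=
  ∃ (u : V) (w : G.Walk z u), w.support = q ∧ IsMonotonePath G oe w ∧ ∀ f ∈ w.edges, e < f

lemma MP_nil (e : Sym2 V) (z : V) : MP G e z [z] :=
  ⟨z, SimpleGraph.Walk.nil, by simp, ⟨by simp, List.isChain_nil⟩, by simp⟩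

lemma MP_mono {e e' : Sym2 V} {z : V} {q : List V} (h : e' ≤ e) (m : MP G e z q) : MP G e' z q := by
  obtain ⟨u, w, h1, h2, h3⟩ := m
  exact ⟨u, w, h1, h2, fun f hf => lt_of_le_of_lt h (h3 f hf)⟩

lemma MP_cons {e' : Sym2 V} {z w : V} {q : List V} (ha : G.Adj z w) (hz : z ∉ q)
    (m : MP G s(z, w) w q) (h : e' < s(z, w)) : MP G e' z (z :: q) := by
  obtain ⟨u, p, h1, h2, h3⟩ := m
  refine ⟨u, SimpleGraph.Walk.cons ha p, by simp [h1], ⟨?_, ?_⟩, ?_⟩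
  · rw [SimpleGraph.Walk.cons_isPath_iff, h1]; exact ⟨h2.1, hz⟩
  · rw [SimpleGraph.Walk.edges_cons]
    refine List.IsChain.cons h2.2 ?_
    intro y hy
    exact h3 y (List.mem_of_mem_head? hy)
  · intro f hf
    rw [SimpleGraph.Walk.edges_cons, List.mem_cons] at hf
    rcases hf with rfl | hf
    · exact h
    · exact h.trans (h3 f hf)

lemma MP_len {K : ℕ} (hK : ∀ (u v : V) (p : G.Walk u v), IsMonotonePath G oe p → p.length ≤ K)
    {e : Sym2 V} {z : V} {q : List V} (m : MP G e z q) : q.length ≤ K + 1 := by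
  obtain ⟨u, p, h1, h2, h3⟩ := m
  have := hK _ _ p h2
  rw [← h1, SimpleGraph.Walk.length_support]; omega

def Has (e : Sym2 V) (z : V) (l : ℕ) : Prop := ∃ q, MP G e z q ∧ l < q.length

open Classical in
noncomputable def lev (k T : ℕ) (e : Sym2 V) (z : V) : ℕ :=
  Nat.findGreatest (fun j => Has G e z (j * k)) T

lemma lev_le (k T : ℕ) (e : Sym2 V) (z : V) : lev G k T e z ≤ T := by
  classical
  unfold lev; exact Nat.findGreatest_le _

lemma lev_has (k T : ℕ) (e : Sym2 V) (z : V) : Has G e z (lev G k T e z * k) := by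
  classical
  have := @Nat.findGreatest_spec 0 (fun j => Has G e z (j * k)) (Classical.decPred _) T (Nat.zero_le _)
    ⟨[z], MP_nil G e z, by simp⟩
  unfold lev
  convert this

lemma lev_not {K k : ℕ} (hk : 0 < k)
    (hK : ∀ (u v : V) (p : G.Walk u v), IsMonotonePath G oe p → p.length ≤ K)
    (e : Sym2 V) (z : V) (q : List V) (m : MP G e z q) :
    q.length ≤ (lev G k (K / k) e z + 1) * k := by
  classical
  by_contra! hc
  by_cases hT : lev G k (K / k) e z + 1 ≤ K / k
  · have := @Nat.findGreatest_is_greatest (lev G k (K / k) e z + 1)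
      (fun j => Has G e z (j * k)) (Classical.decPred _) (K / k) (by unfold lev; convert Nat.lt_succ_self _) hT
    exact this ⟨q, m, hc⟩
  · have h1 := MP_len G hK m
    have h2 : K < (K / k + 1) * k := by
      have := Nat.lt_div_mul_add (a := K) hk
      linarith
    have : (K / k + 1) * k ≤ (lev G k (K / k) e z + 1) * k :=
      Nat.mul_le_mul_right _ (by omega)
    omega

lemma exists_P [Fintype V] {K : ℕ} (k : ℕ)
    (hK : ∀ (u v : V) (p : G.Walk u v), IsMonotonePath G oe p → p.length ≤ K) :
    ∃ P : V → ℕ → List V, ∀ v j, (P v j).length ≤ K + 1 ∧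
      ∀ e, Has G e v (j * k) → j * k < (P v j).length ∧ MP G e v (P v j) := by
  classical
  have : ∀ v j, ∃ q : List V, q.length ≤ K + 1 ∧
      ∀ e, Has G e v (j * k) → j * k < q.length ∧ MP G e v q := by
    intro v j
    by_cases hne : ∃ e, Has G e v (j * k)
    · obtain ⟨e0, he0⟩ := hne
      obtain ⟨m, hm, hmax⟩ := Finset.exists_max_image
        (Finset.univ.filter (fun e => Has G e v (j * k))) id ⟨e0, by simpa using he0⟩
      rw [Finset.mem_filter] at hm
      obtain ⟨q, hq, hl⟩ := hm.2
      refine ⟨q, MP_len G hK hq, fun e he => ⟨hl, MP_mono G (hmax e (by simpa using he)) hq⟩⟩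
    · exact ⟨[v], by simp, fun e he => (hne ⟨e, he⟩).elim⟩
  choose P hP using this
  exact ⟨P, hP⟩

lemma exists_desc {α : Type*} [LinearOrder α] [Nonempty α] (S : Finset α) :
    ∃ f : ℕ → α, (∀ i < S.card, f i ∈ S) ∧ ∀ i j, i < j → j < S.card → f j < f i := by
  classical
  let em := S.orderEmbOfFin rfl
  refine ⟨fun i => if h : i < S.card then em (Fin.rev ⟨i, h⟩) else Classical.arbitrary α, ?_, ?_⟩
  · intro i hi
    simp only [hi, dite_true]
    exact S.orderEmbOfFin_mem rfl _
  · intro i j hij hj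
    have hi : i < S.card := by omega
    simp only [hi, hj, dite_true]
    rw [OrderEmbedding.lt_iff_lt, Fin.rev_lt_rev]
    exact hij

open Classical in
/-- Edges whose endpoints have the same level. -/
lemma equal_level [Fintype V] [Nonempty V] {K k : ℕ} (hk : 0 < k)
    (hK : ∀ (u v : V) (p : G.Walk u v), IsMonotonePath G oe p → p.length ≤ K) (j : ℕ)
    (S : Finset (Sym2 V)) (hS : ∀ e ∈ S, e ∈ G.edgeSet)
    (hl : ∀ e ∈ S, ∀ z ∈ e, lev G k (K / k) e z = j) :
    (S.card : ℝ) ≤ Fintype.card V * (4 * (K + 1 + k * k + k : ℕ) +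
      (12 * (K + 1 + k * k + k : ℕ) + 6) * log (Fintype.card V)) := by
  obtain ⟨P, hP⟩ := exists_P G k hK
  have : Nonempty (Sym2 V) := ⟨s(Classical.arbitrary V, Classical.arbitrary V)⟩
  obtain ⟨f, hf, hd⟩ := exists_desc S
  have hr : ∀ i, ∃ x y, f i = s(x, y) := by
    intro i
    induction f i using Sym2.ind with
    | _ x y => exact ⟨x, y, rfl⟩
  choose x y hxy using hr
  have adj : ∀ i < S.card, ∀ z w, s(z, w) = s(x i, y i) → G.Adj z w := by
    intro i hi z w h
    have := hS _ (hf i hi)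
    rw [hxy, ← h] at this
    exact this
  have hne : ∀ i < S.card, x i ≠ y i := fun i hi => (adj i hi _ _ rfl).ne
  refine process_lemma S.card k _ x y hne ?_ (fun v => P v j) ?_ ?_
  · intro i hi i' hi' h
    rw [← hxy, ← hxy] at h
    rcases lt_trichotomy i i' with h' | h' | h'
    · exact absurd h (hd _ _ h' hi').ne'
    · exact h'
    · exact absurd h (hd _ _ h' hi).ne
  · intro v
    have := (hP v j).1
    omega
  · intro v i hi z hz q hq
    have hhas : ∀ i < S.card, ∀ z ∈ f i, Has G (f i) z (j * k) := by
      intro i hi z hz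
      rw [← hl _ (hf i hi) z hz]; exact lev_has G _ _ _ _
    have inv := st_inv x y v (P v j) S.card hne
      (fun i z q => (∀ i', i ≤ i' → i' < S.card → z ∈ f i' → MP G (f i') z q) ∧
        (z = v ∨ ∃ i' < S.card, v ∈ f i')) ?_ ?_ ?_ i hi.le z q hq
    · obtain ⟨h1, h2⟩ := inv
      rw [← hxy] at hz
      have h3 := lev_not G hk hK _ _ _ (h1 i le_rfl hi hz)
      rw [hl _ (hf i hi) z hz] at h3
      have h4 : j * k < (P v j).length := by
        rcases h2 with rfl | ⟨i', hi', hv⟩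
        · exact ((hP z j).2 _ (hhas i hi z hz)).1
        · exact ((hP v j).2 _ (hhas i' hi' v hv)).1
      have : (j + 1) * k = j * k + k := by ring
      omega
    · refine ⟨fun i' _ hi' hv => ((hP v j).2 _ (hhas i' hi' v hv)).2, Or.inl rfl⟩
    · rintro i z q ⟨h1, h2⟩
      exact ⟨fun i' h => h1 i' (by omega), h2⟩
    · rintro i hi z w q e ⟨h1, h2⟩ hz _
      have hfi : f i = s(z, w) := by rw [e, hxy]
      have hw : w ∈ f i := by rw [hfi]; simp
      refine ⟨fun i' h hi' _ => ?_, Or.inr ?_⟩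
      · have m := h1 i le_rfl hi hw
        rw [hfi] at m
        refine MP_cons G (adj i hi z w e) hz m ?_
        rw [← hfi]; exact hd _ _ (by omega) hi'
      · rcases h2 with rfl | h2
        · exact ⟨i, hi, hw⟩
        · exact h2

open Classical in
lemma edge_bound [Fintype V] [Nonempty V] {K k : ℕ} (hk : 0 < k)
    (hK : ∀ (u v : V) (p : G.Walk u v), IsMonotonePath G oe p → p.length ≤ K) :
    (G.edgeSet.ncard : ℝ) ≤ Fintype.card V * ((K / k : ℕ) + 1) * ((4 * (K + 1 + k * k + k : ℕ) +
      (12 * (K + 1 + k * k + k : ℕ) + 6) * log (Fintype.card V)) + K + 2) := by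
  obtain ⟨P, hP⟩ := exists_P G k hK
  set T := K / k with hT
  set B : ℝ := (4 * (K + 1 + k * k + k : ℕ) +
      (12 * (K + 1 + k * k + k : ℕ) + 6) * log (Fintype.card V)) with hB
  let E : Finset (Sym2 V) := Finset.univ.filter (fun e => e ∈ G.edgeSet)
  have hE : G.edgeSet.ncard = E.card := by
    rw [← Set.ncard_coe_finset]; congr 1; ext e; simp [E]
  let lv := fun e z => lev G k T e z
  let Ej : ℕ → Finset (Sym2 V) := fun j => E.filter (fun e => ∀ z ∈ e, lv e z = j)
  let A : Finset (Sym2 V) := (Finset.univ ×ˢ Finset.range (T+1)).biUnion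
    (fun p : V × ℕ => (P p.1 p.2).toFinset.image (fun a => s(a, p.1)))
  let C : Finset (Sym2 V) := E.filter (fun e => ∃ x y, e = s(x, y) ∧ lv e x < lv e y ∧ x ∉ P y (lv e y))
  have cover : E ⊆ (Finset.range (T+1)).biUnion Ej ∪ (A ∪ C) := by
    intro e he
    have main : ∀ x y, e = s(x, y) → lv e x < lv e y → e ∈ A ∪ C := by
      intro x y hxy hlt
      rw [Finset.mem_union]
      by_cases hx : x ∈ P y (lv e y)
      · left
        simp only [A, Finset.mem_biUnion, Finset.mem_image]
        refine ⟨(y, lv e y), ?_, x, by simpa using hx, hxy.symm⟩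
        simp only [Finset.mem_product, Finset.mem_univ, Finset.mem_range, true_and]
        exact Nat.lt_succ_of_le (lev_le G _ _ _ _)
      · right
        exact Finset.mem_filter.2 ⟨he, x, y, hxy, hlt, hx⟩
    obtain ⟨x, y, hxy⟩ : ∃ x y, e = s(x, y) := by
      induction e using Sym2.ind with
      | _ x y => exact ⟨x, y, rfl⟩
    rw [Finset.mem_union]
    rcases lt_trichotomy (lv e x) (lv e y) with h | h | h
    · right; exact main x y hxy h
    · left
      rw [Finset.mem_biUnion]
      refine ⟨lv e x, ?_, Finset.mem_filter.2 ⟨he, ?_⟩⟩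
      · rw [Finset.mem_range]; exact Nat.lt_succ_of_le (lev_le G _ _ _ _)
      · intro z hz
        rw [hxy, Sym2.mem_iff] at hz
        rcases hz with rfl | rfl
        · rfl
        · exact h.symm
    · right; exact main y x (by rw [hxy, Sym2.eq_swap]) h
  have cA : A.card ≤ Fintype.card V * (T+1) * (K+1) := by
    refine (Finset.card_biUnion_le_card_mul _ _ (K+1) ?_).trans ?_
    · intro p _
      exact Finset.card_image_le.trans ((List.toFinset_card_le _).trans (hP _ _).1)
    · rw [Finset.card_product, Finset.card_range, Finset.card_univ]
  have cC : C.card ≤ Fintype.card V * (T+1) := by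
    have h : ∀ e ∈ C, ∃ x y, e = s(x, y) ∧ lv e x < lv e y ∧ x ∉ P y (lv e y) :=
      fun e he => (Finset.mem_filter.1 he).2
    choose! gx gy h1 h2 h3 using h
    have : (Finset.univ ×ˢ Finset.range (T+1) : Finset (V × ℕ)).card = Fintype.card V * (T+1) := by
      rw [Finset.card_product, Finset.card_range, Finset.card_univ]
    rw [← this]
    refine Finset.card_le_card_of_injOn (fun e => (gx e, lv e (gx e))) ?_ ?_
    · intro e he
      simp only [Finset.coe_product, Finset.coe_univ, Finset.coe_range, Set.mem_prod, Set.mem_univ, true_and, Set.mem_Iio]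
      exact Nat.lt_succ_of_le (lev_le G _ _ _ _)
    · have key : ∀ e ∈ C, ∀ e' ∈ C, e' < e → gx e = gx e' → lv e (gx e) = lv e' (gx e') → False := by
        intro e he e' he' hlt hx hl
        have hm := ((hP (gy e) (lv e (gy e))).2 e (lev_has G _ _ _ _))
        have hadj : G.Adj (gx e) (gy e) := by
          have : e ∈ G.edgeSet := (Finset.mem_filter.1 (Finset.mem_filter.1 he).1).2
          rw [h1 e he] at this
          exact this
        have m : MP G s(gx e, gy e) (gy e) (P (gy e) (lv e (gy e))) := by
          rw [← h1 e he]; exact hm.2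
        have m' := MP_cons G (e' := e') hadj (h3 e he) m (by rw [← h1 e he]; exact hlt)
        have c := lev_not G hk hK _ _ _ m'
        have c2 : lev G k (K / k) e' (gx e) = lv e (gx e) := by rw [hl, hx]
        rw [c2] at c
        have c3 : (lv e (gx e) + 1) * k ≤ lv e (gy e) * k := Nat.mul_le_mul_right _ (h2 e he)
        have c4 := hm.1
        simp only [List.length_cons] at c
        omega
      intro e he e' he' heq
      have e1 := congrArg Prod.fst heq
      have e2 := congrArg Prod.snd heq
      dsimp only at e1 e2
      rcases lt_trichotomy e e' with h | h | h
      · exact (key e' he' e he h e1.symm e2.symm).elim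
      · exact h
      · exact (key e he e' he' h e1 e2).elim
  have cE : ∀ j, ((Ej j).card : ℝ) ≤ Fintype.card V * B := by
    intro j
    refine equal_level G hk hK j (Ej j) ?_ ?_
    · intro e he; exact (Finset.mem_filter.1 (Finset.mem_filter.1 he).1).2
    · intro e he; exact (Finset.mem_filter.1 he).2
  have cU : (((Finset.range (T+1)).biUnion Ej).card : ℝ) ≤ (T+1) * (Fintype.card V * B) := by
    calc (((Finset.range (T+1)).biUnion Ej).card : ℝ) ≤ ((∑ j ∈ Finset.range (T+1), (Ej j).card : ℕ) : ℝ) := by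
          exact_mod_cast Finset.card_biUnion_le
      _ ≤ ∑ j ∈ Finset.range (T+1), (Fintype.card V * B : ℝ) := by
          push_cast; exact Finset.sum_le_sum fun j _ => cE j
      _ = _ := by simp
  have t1 := Finset.card_le_card cover
  have t2 := Finset.card_union_le ((Finset.range (T+1)).biUnion Ej) (A ∪ C)
  have t3 := Finset.card_union_le A C
  have t4 : (E.card : ℝ) ≤ ((Finset.range (T+1)).biUnion Ej).card + A.card + C.card := by
    exact_mod_cast (by omega : E.card ≤ ((Finset.range (T+1)).biUnion Ej).card + A.card + C.card)
  have cA' : (A.card : ℝ) ≤ Fintype.card V * (T+1) * (K+1) := by exact_mod_cast cA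
  have cC' : (C.card : ℝ) ≤ Fintype.card V * (T+1) := by exact_mod_cast cC
  rw [hE]
  have : (Fintype.card V * (T + 1) * (B + K + 2) : ℝ) = (T+1) * (Fintype.card V * B) +
    Fintype.card V * (T+1) * (K+1) + Fintype.card V * (T+1) := by ring
  rw [this]
  linarith

end graph


lemma numerics (n K : ℕ) (E s L d : ℝ) (hL : 22 ≤ L) (hs0 : 0 < s) (hs3 : s ^ 3 = n * L ^ 2)
    (hlog : log n ≤ 0.0631 * L) (hlog0 : 0 ≤ log n) (hn : 0 < (n : ℝ)) (hd : d = 2 * E / n) (hdn : d < n)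
    (hK : 4 * s * (K + s) < d)
    (hE : ∀ k : ℕ, 0 < k → E ≤ n * ((K / k : ℕ) + 1) * ((4 * (K + 1 + k * k + k : ℕ) +
      (12 * (K + 1 + k * k + k : ℕ) + 6) * log n) + K + 2)) : False := by
  have hL0 : 0 < L := by linarith
  obtain ⟨z, hz⟩ : ∃ z, s = z * L := ⟨s / L, by field_simp⟩
  have hz0 : 0 < z := by
    rcases lt_or_ge 0 z with h | h
    · exact h
    · nlinarith
  have hnz : (n : ℝ) = z ^ 3 * L := by
    have : (n : ℝ) * L ^ 2 = (z ^ 3 * L) * L ^ 2 := by rw [← hs3, hz]; ring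
    exact mul_right_cancel₀ (by positivity) this
  have hK0 : (0 : ℝ) ≤ K := Nat.cast_nonneg K
  have hlt : 4 * s * (K + s) < z ^ 3 * L := by linarith
  have h4 : 4 * (K + s) < z ^ 2 := by
    have : (z * L) * (4 * (K + s)) < (z * L) * z ^ 2 := by rw [hz] at hlt ⊢; linarith
    exact lt_of_mul_lt_mul_left this (by positivity)
  have h5 : 4 * L < z := by
    have : z * (4 * L) < z * z := by rw [hz] at h4; nlinarith
    exact lt_of_mul_lt_mul_left this hz0.le
  have h88 : 88 < z := by linarith
  have hK4 : (K : ℝ) ≤ z ^ 2 / 4 := by linarith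
  set k := ⌈z / 2⌉₊ with hk
  have k1 : z / 2 ≤ k := Nat.le_ceil _
  have k2 : (k : ℝ) < z / 2 + 1 := Nat.ceil_lt_add_one (by positivity)
  have kpos : 0 < (k : ℝ) := by linarith
  have h := hE k (by exact_mod_cast kpos)
  set Q : ℝ := ((K + 1 + k * k + k : ℕ) : ℝ) with hQ
  have hQ1 : Q ≤ z ^ 2 / 2 + 3 / 2 * z + 3 := by
    rw [hQ]; push_cast
    have : (k : ℝ) * k ≤ (z / 2 + 1) * (z / 2 + 1) := mul_self_le_mul_self kpos.le k2.le
    linarith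
  have hQ0 : 0 ≤ Q := Nat.cast_nonneg _
  have hz2 : 88 * z ≤ z ^ 2 := by nlinarith
  have hzL : 22 * z ^ 2 ≤ z ^ 2 * L := by nlinarith [sq_nonneg z]
  have hB : 4 * Q + (12 * Q + 6) * log n + K + 2 ≤ z ^ 2 * L := by
    have e1 : (12 * Q + 6) * log n ≤ (7 * z ^ 2) * (0.0631 * L) := by
      apply mul_le_mul _ hlog hlog0 (by positivity)
      linarith
    linarith
  have hT : ((K / k : ℕ) : ℝ) ≤ K / k := Nat.cast_div_le
  have h6 : E ≤ n * ((K : ℝ) / k + 1) * (z ^ 2 * L) := by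
    refine h.trans ?_
    have : 0 ≤ 4 * Q + (12 * Q + 6) * log n + K + 2 := by positivity
    gcongr
  have h7 : ((K : ℝ) / k + 1) * (z ^ 2 * L) ≤ 2 * s * (K + k) := by
    have e : (2 : ℝ) * s * (K + k) = ((K : ℝ) / k + 1) * (2 * s * k) := by field_simp
    rw [e]
    apply mul_le_mul_of_nonneg_left _ (by positivity)
    rw [hz]
    have : z * L * z ≤ z * L * (2 * k) := mul_le_mul_of_nonneg_left (by linarith) (by positivity)
    linarith
  have h8 : d / 2 ≤ 2 * s * (K + k) := by
    have : d / 2 = E / n := by rw [hd]; ring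
    rw [this, div_le_iff₀ hn]
    nlinarith
  have h9 : (k : ℝ) ≤ s := by rw [hz]; nlinarith
  have : 2 * s * (K + k) ≤ 2 * s * (K + s) := by gcongr
  linarith

end helpers

/-- Theorem `dense` of the paper.  Let `G` be an `n`-vertex graph,
let `s = n^(1/3)·(11·lg n)^(2/3)`, and suppose `n` is large enough that `s ≤ n − 2`.
If `G` has average degree `d = 2|E(G)|/n` and `d > 2`, then
`f(G) > (d/(4s))·(1 − 2/d)·(1 − 1/s)·(1 − 4s²/(d − 2))`, i.e. every edge-ordering of
`G` contains a monotone path strictly longer than this quantity. -/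
theorem altitude_dense {V : Type*} [Fintype V] (G : SimpleGraph V) (n : ℕ)
    (hn : Fintype.card V = n) (s : ℝ)
    (hs : s = (n : ℝ) ^ ((1 : ℝ) / 3) * (11 * Real.logb 2 n) ^ ((2 : ℝ) / 3))
    (hsn : s ≤ (n : ℝ) - 2) (d : ℝ) (hd : d = 2 * G.edgeSet.ncard / n)
    (hd2 : 2 < d) (oe : LinearOrder (Sym2 V)) :
    ∃ (u v : V) (p : G.Walk u v), IsMonotonePath G oe p ∧
      d / (4 * s) * (1 - 2 / d) * (1 - 1 / s) * (1 - 4 * s ^ 2 / (d - 2)) <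
        (p.length : ℝ) := by
  classical
  have hn0 : n ≠ 0 := by
    rintro rfl
    simp at hd; linarith
  have hnpos : (0 : ℝ) < n := by exact_mod_cast Nat.pos_of_ne_zero hn0
  have : Nonempty V := by
    rw [← Fintype.card_pos_iff, hn]; omega
  have hdn : d ≤ n - 1 := by
    have h1 : G.edgeSet.ncard ≤ n.choose 2 := by
      rw [← hn, ← SimpleGraph.coe_edgeFinset, Set.ncard_coe_finset]
      exact SimpleGraph.card_edgeFinset_le_card_choose_two
    have h2 : (G.edgeSet.ncard : ℝ) ≤ n * (n - 1) / 2 := by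
      rw [← Nat.cast_choose_two]; exact_mod_cast h1
    rw [hd, div_le_iff₀ hnpos]; linarith
  have hn4 : 4 ≤ n := by
    have : (3 : ℝ) < n := by linarith
    have : 3 < n := by exact_mod_cast this
    omega
  set L : ℝ := 11 * Real.logb 2 n with hL
  have hL22 : 22 ≤ L := by
    have : (2 : ℝ) ≤ Real.logb 2 n := by
      rw [Real.le_logb_iff_rpow_le (by norm_num) hnpos]
      have : (4 : ℝ) ≤ n := by exact_mod_cast hn4
      norm_num; exact hn4
    linarith
  have hs0 : 0 < s := by rw [hs]; positivity
  have hs3 : s ^ 3 = n * L ^ 2 := by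
    rw [hs, mul_pow, ← Real.rpow_natCast, ← Real.rpow_mul hnpos.le, ← Real.rpow_natCast,
      ← Real.rpow_mul (by linarith)]
    norm_num
  have hs1 : 1 < s := by
    by_contra! h
    have h1 : s ^ 3 ≤ 1 := pow_le_one₀ hs0.le h
    have : (4 : ℝ) ≤ n := by exact_mod_cast hn4
    nlinarith
  have hlog : Real.log n ≤ 0.0631 * L := by
    have e : Real.log n = L * Real.log 2 / 11 := by
      rw [hL, Real.logb]
      have : Real.log 2 ≠ 0 := (Real.log_pos (by norm_num)).ne'
      field_simp
    rw [e]
    have := Real.log_two_lt_d9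
    nlinarith
  have hlog0 : 0 ≤ Real.log n := Real.log_nonneg (by exact_mod_cast Nat.one_le_iff_ne_zero.2 hn0)
  set τ : ℝ := d / (4 * s) * (1 - 2 / d) * (1 - 1 / s) * (1 - 4 * s ^ 2 / (d - 2)) with hτ
  have hd0 : 0 < d := by linarith
  have hd2' : 0 < d - 2 := by linarith
  have f1 : d / (4 * s) * (1 - 2 / d) = (d - 2) / (4 * s) := by field_simp
  have f2 : 0 ≤ 1 - 1 / s := by
    have : 1 / s ≤ 1 := by rw [div_le_one hs0]; exact hs1.le
    linarith
  have f3 : 1 - 1 / s ≤ 1 := by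
    have : 0 < 1 / s := by positivity
    linarith
  have hedge : ∃ a b, G.Adj a b := by
    by_contra! hc
    have : G.edgeSet = ∅ := by
      ext e
      induction e using Sym2.ind with
      | _ a b => simp [hc a b]
    rw [this] at hd
    simp at hd; linarith
  obtain ⟨a, b, hab⟩ := hedge
  by_cases hcase : d - 2 ≤ 4 * s ^ 2
  · refine ⟨a, b, SimpleGraph.Walk.cons hab SimpleGraph.Walk.nil, ⟨?_, ?_⟩, ?_⟩
    · simp [hab.ne]
    · exact List.isChain_singleton _
    · have : τ ≤ 0 := by
        rw [hτ, f1]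
        apply mul_nonpos_of_nonneg_of_nonpos
        · positivity
        · have : 1 ≤ 4 * s ^ 2 / (d - 2) := by rw [le_div_iff₀ hd2']; linarith
          linarith
      refine this.trans_lt ?_
      simp
  · push Not at hcase
    by_contra! hcon
    have hτ0 : 0 ≤ τ := by
      have := hcon a a SimpleGraph.Walk.nil ⟨by simp, List.isChain_nil⟩
      simpa using this
    have hK : ∀ (u v : V) (p : G.Walk u v), IsMonotonePath G oe p → p.length ≤ ⌊τ⌋₊ :=
      fun u v p hp => Nat.le_floor (hcon u v p hp)
    have hτ1 : τ ≤ (d - 2 - 4 * s ^ 2) / (4 * s) := by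
      have e : τ = (d - 2 - 4 * s ^ 2) / (4 * s) * (1 - 1 / s) := by
        rw [hτ, f1]; field_simp
      rw [e]
      have : 0 ≤ (d - 2 - 4 * s ^ 2) / (4 * s) := div_nonneg (by linarith) (by positivity)
      exact mul_le_of_le_one_right this f3
    have hKτ : ((⌊τ⌋₊ : ℕ) : ℝ) ≤ τ := Nat.floor_le hτ0
    have h4 : ((⌊τ⌋₊ : ℕ) : ℝ) * (4 * s) ≤ d - 2 - 4 * s ^ 2 := by
      rw [← le_div_iff₀ (by positivity)]; exact hKτ.trans hτ1
    refine numerics n ⌊τ⌋₊ G.edgeSet.ncard s L d hL22 hs0 hs3 hlog hlog0 hnpos hd (by linarith)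
      (by nlinarith) ?_
    intro k hk
    have := edge_bound G (oe := oe) hk hK
    rw [hn] at this
    exact this

end AltitudePaper
end

section
/- f(K_n) ≥ (1/20 − o(1))·(n/lg n)^{2/3}: for every ε > 0 there exists N such that for all n ≥ N, every edge-ordering of the complete graph K_n contains a monotone path of length at least (1/20 − ε)·(n/lg n)^{2/3}, where lg denotes the base-2 logarithm. -/
namespace AltitudePaper

variable {V : Type*}

section Helpers

variable {α : Type*} [LinearOrder α]

open Classical in
/-- Remove from `E` every edge which is the largest one at one of its endpoints. -/
noncomputable def del (r : Sym2 V → α) (E : Finset (Sym2 V)) : Finset (Sym2 V) :=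
  E.filter (fun e => ∀ u ∈ e, ∃ g ∈ E, u ∈ g ∧ r e < r g)

/-- Iterated deletion. -/
noncomputable def lay (r : Sym2 V → α) (E : Finset (Sym2 V)) : ℕ → Finset (Sym2 V)
  | 0 => E
  | m + 1 => del r (lay r E m)

lemma lay_anti (r : Sym2 V → α) (E : Finset (Sym2 V)) {i j : ℕ} (h : i ≤ j) :
    lay r E j ⊆ lay r E i := by
  induction h with
  | refl => exact Finset.Subset.refl _
  | step _ ih =>
    intro e he
    classical
    exact ih (Finset.mem_filter.1 he).1

open Classical in
lemma chain_card (r : Sym2 V → α) (E : Finset (Sym2 V)) (u : V) (f : Sym2 V) (hu : u ∈ f)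
    (j : ℕ) : ∀ i, f ∈ lay r E (i + j) →
      j ≤ ((lay r E i).filter (fun e => u ∈ e ∧ r f < r e)).card := by
  induction j with
  | zero => intro i _; exact Nat.zero_le _
  | succ j ih =>
    intro i hf
    have h1 := ih (i + 1) (by rwa [show i + 1 + j = i + (j + 1) by omega])
    set B := (lay r E (i + 1)).filter (fun e => u ∈ e ∧ r f < r e) with hB
    obtain ⟨e, he, hmax⟩ := Finset.exists_max_image (insert f B) r ⟨f, Finset.mem_insert_self _ _⟩
    have hfl : f ∈ lay r E (i + 1) := lay_anti r E (by omega) hf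
    have hel : e ∈ lay r E (i + 1) ∧ u ∈ e := by
      rcases Finset.mem_insert.1 he with rfl | h
      · exact ⟨hfl, hu⟩
      · rw [hB, Finset.mem_filter] at h
        exact ⟨h.1, h.2.1⟩
    have hd : e ∈ del r (lay r E i) := hel.1
    rw [del, Finset.mem_filter] at hd
    obtain ⟨e', he', hue', hlt⟩ := hd.2 u hel.2
    have hnot : e' ∉ B := fun h => absurd (hmax e' (Finset.mem_insert_of_mem h)) (not_le.2 hlt)
    have hsub : insert e' B ⊆ (lay r E i).filter (fun e => u ∈ e ∧ r f < r e) := by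
      intro x hx
      rcases Finset.mem_insert.1 hx with rfl | h
      · exact Finset.mem_filter.2
          ⟨he', hue', lt_of_le_of_lt (hmax f (Finset.mem_insert_self _ _)) hlt⟩
      · rw [hB, Finset.mem_filter] at h
        exact Finset.mem_filter.2 ⟨lay_anti r E (Nat.le_succ i) h.1, h.2⟩
    have := Finset.card_le_card hsub
    rw [Finset.card_insert_of_notMem hnot] at this
    omega

lemma del_card (r : Sym2 V → α) (hr : Function.Injective r) (E : Finset (Sym2 V))
    (S : Finset V) (hS : ∀ e ∈ E, ∀ u ∈ e, u ∈ S) :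
    E.card ≤ (del r E).card + S.card := by
  classical
  have hsub : del r E ⊆ E := Finset.filter_subset _ _
  have h1 : (E \ del r E).card ≤ S.card := by
    have : ∀ e ∈ E \ del r E, ∃ u, u ∈ e ∧ ∀ e' ∈ E, u ∈ e' → r e' ≤ r e := by
      intro e he
      rw [Finset.mem_sdiff, del, Finset.mem_filter] at he
      obtain ⟨h1, h2⟩ := he
      by_contra hc
      apply h2
      refine ⟨h1, fun u hu => ?_⟩
      by_contra hc2
      apply hc
      refine ⟨u, hu, fun e' he' hue' => ?_⟩
      by_contra hc3
      exact hc2 ⟨e', he', hue', not_le.1 hc3⟩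
    choose g hg using this
    have := Finset.card_le_card_of_injOn (s := (E \ del r E).attach) (t := S)
      (fun e => g e.1 e.2) ?_ ?_
    · simpa using this
    · intro e _
      exact hS e.1 (Finset.mem_sdiff.1 e.2).1 _ (hg e.1 e.2).1
    · intro e _ e' _ h
      have h : g e.1 e.2 = g e'.1 e'.2 := h
      apply Subtype.ext
      apply hr
      apply le_antisymm
      · exact (hg e'.1 e'.2).2 e.1 (Finset.mem_sdiff.1 e.2).1 (h ▸ (hg e.1 e.2).1)
      · exact (hg e.1 e.2).2 e'.1 (Finset.mem_sdiff.1 e'.2).1 (h ▸ (hg e'.1 e'.2).1)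
  have h2 := Finset.card_sdiff_add_card_eq_card hsub
  omega

lemma lay_card (r : Sym2 V → α) (hr : Function.Injective r) (E : Finset (Sym2 V))
    (S : Finset V) (hS : ∀ e ∈ E, ∀ u ∈ e, u ∈ S) (m : ℕ) :
    E.card ≤ (lay r E m).card + m * S.card := by
  induction m with
  | zero => simp [lay]
  | succ m ih =>
    have := del_card r hr (lay r E m) S
      (fun e he => hS e (lay_anti r E (Nat.zero_le m) he))
    rw [lay, Nat.succ_mul]
    omega

/-- `MPath r l t`: the list `l` (last vertex first) is a monotone path all of whose edges
have rank at most `t`. -/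
inductive MPath (r : Sym2 V → α) : List V → α → Prop
  | single (u : V) (t : α) : MPath r [u] t
  | cons (v u : V) (l : List V) (t t' : α) : MPath r (u :: l) t → v ∉ u :: l →
      t < r s(u, v) → r s(u, v) ≤ t' → MPath r (v :: u :: l) t'

lemma MPath.mono {r : Sym2 V → α} {l : List V} {t t' : α} (h : MPath r l t) (htt : t ≤ t') :
    MPath r l t' := by
  cases h with
  | single u => exact MPath.single u t'
  | cons v u l t0 _ h1 h2 h3 h4 => exact MPath.cons v u l t0 t' h1 h2 h3 (h4.trans htt)

open Classical in
lemma greedy (r : Sym2 V → α) (H : Finset (Sym2 V)) (S : Finset V)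
    (hS : ∀ e ∈ H, ∀ u ∈ e, u ∈ S) (a : ℕ) :
    ∀ (b m : ℕ) (l : List V) (u : V) (f : Sym2 V), MPath r (u :: l) (r f) → u ∈ f →
      f ∈ lay r H m → ((u :: l).toFinset ∩ S).card ≤ b → a * (a + b) ≤ m →
      ∃ (l' : List V) (u' : V) (f' : Sym2 V), l'.length = l.length + a ∧
        MPath r (u' :: l') (r f') ∧ u' ∈ f' ∧ f' ∈ H := by
  induction a with
  | zero =>
    intro b m l u f h1 h2 h3 _ _
    exact ⟨l, u, f, rfl, h1, h2, lay_anti r H (Nat.zero_le m) h3⟩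
  | succ a ih =>
    intro b m l u f h1 h2 h3 h4 h5
    have e1 : (a + 1) * (a + 1 + b) = a * (a + (b + 1)) + (a + 1 + b) := by ring
    obtain ⟨i, rfl⟩ : ∃ i, m = i + (b + 1) := ⟨m - (b + 1), by omega⟩
    have hc := chain_card r H u f h2 (b + 1) i h3
    set B := (lay r H i).filter (fun e => u ∈ e ∧ r f < r e) with hB
    have : ∃ v, s(u, v) ∈ B ∧ v ∉ u :: l := by
      by_contra hcon
      push Not at hcon
      have : B ⊆ ((u :: l).toFinset ∩ S).image (fun v => s(u, v)) := by
        intro e he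
        have he' := he
        rw [hB, Finset.mem_filter] at he'
        obtain ⟨v, rfl⟩ := he'.2.1
        refine Finset.mem_image.2 ⟨v, Finset.mem_inter.2 ⟨?_, ?_⟩, rfl⟩
        · exact List.mem_toFinset.2 (hcon v he)
        · exact hS _ (lay_anti r H (Nat.zero_le i) he'.1) v (Sym2.mem_mk_right u v)
      have := (Finset.card_le_card this).trans Finset.card_image_le
      omega
    obtain ⟨v, hv, hvl⟩ := this
    rw [hB, Finset.mem_filter] at hv
    obtain ⟨l', u', f', g1, g2⟩ := ih (b + 1) i (u :: l) v s(u, v)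
      (MPath.cons v u l _ _ h1 hvl hv.2.2 le_rfl) (Sym2.mem_mk_right u v) hv.1 (by
        rw [List.toFinset_cons]
        by_cases hvS : v ∈ S
        · rw [Finset.insert_inter_of_mem hvS]
          exact (Finset.card_insert_le _ _).trans (by omega)
        · rw [Finset.insert_inter_of_notMem hvS]; omega) (by omega)
    refine ⟨l', u', f', ?_, g2⟩
    rw [g1, List.length_cons]; omega

open Classical in
lemma chunk [Fintype V] (r : Sym2 V → α) (hr : Function.Injective r) (E : Finset (Sym2 V))
    (a Q K w m i : ℕ) (hQ : Fintype.card V < 2 ^ Q) (hm : a * (a + Q) ≤ m)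
    (hw : K + 4 * m + 1 ≤ w) (l : List V) (x : V) (f : Sym2 V) (hp : MPath r (x :: l) (r f))
    (hxf : x ∈ f) (hf : f ∈ lay r E (i + Q * w)) (hK : (x :: l).length ≤ K) :
    ∃ (l' : List V) (u' : V) (f' : Sym2 V), l.length + a ≤ l'.length ∧
        MPath r (u' :: l') (r f') ∧ u' ∈ f' ∧ f' ∈ lay r E i := by
  by_contra hno
  set X := (x :: l).toFinset with hX
  have hXK : X.card ≤ K := (List.toFinset_card_le _).trans hK
  have key : ∀ q j, q + j = Q → ∃ S : Finset V, x ∈ S ∧ (∀ y ∈ S, y ∈ X → y = x) ∧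
      2 ^ q ≤ S.card ∧ ∀ u ∈ S, ∃ (lu : List V) (fu : Sym2 V), MPath r (u :: lu) (r fu) ∧
        u ∈ fu ∧ fu ∈ lay r E (i + j * w) ∧ l.length ≤ lu.length ∧
        (∀ y ∈ u :: lu, y ∈ S ∨ y ∈ X) ∧ ((u :: lu).toFinset \ X).card ≤ q := by
    intro q
    induction q with
    | zero =>
      intro j hj
      obtain rfl : j = Q := by omega
      refine ⟨{x}, by simp, by simp, by simp, ?_⟩
      intro u hu
      obtain rfl := Finset.mem_singleton.1 hu
      refine ⟨l, f, hp, hxf, hf, le_rfl, fun y hy => Or.inr (List.mem_toFinset.2 hy), ?_⟩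
      simp [hX]
    | succ q ih =>
      intro j hj
      obtain ⟨S, hxS, hSX, hSc, hS⟩ := ih (j + 1) (by omega)
      have : Nonempty (Sym2 V) := ⟨f⟩
      choose! lu fu h1 h2 h3 h4 h5 h6 using hS
      set R := i + j * w with hR
      have hRw : i + (j + 1) * w = R + w := by rw [hR]; ring
      rw [hRw] at h3
      set B : V → Finset (Sym2 V) :=
        fun u => (lay r E R).filter (fun e => u ∈ e ∧ r (fu u) < r e) with hB
      have hBc : ∀ u ∈ S, w ≤ (B u).card := fun u hu =>
        chain_card r E u (fu u) (h2 u hu) w R (h3 u hu)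
      set C : V → Finset (Sym2 V) :=
        fun u => (B u).filter (fun e => ∀ v, e = s(u, v) → v ∉ X) with hC
      have hCm : ∀ u e, e ∈ C u → e ∈ lay r E R ∧ u ∈ e ∧ r (fu u) < r e ∧
          ∀ v, e = s(u, v) → v ∉ X := by
        intro u e he
        rw [hC] at he
        have h := Finset.mem_filter.1 he
        have h' := Finset.mem_filter.1 h.1
        exact ⟨h'.1, h'.2.1, h'.2.2, h.2⟩
      have hCc : ∀ u ∈ S, w - K ≤ (C u).card := by
        intro u hu
        have hsub : B u \ C u ⊆ X.image (fun v => s(u, v)) := by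
          intro e he
          rw [Finset.mem_sdiff] at he
          obtain ⟨he1, he2⟩ := he
          have : ¬ ∀ v, e = s(u, v) → v ∉ X := fun h => he2 (Finset.mem_filter.2 ⟨he1, h⟩)
          push Not at this
          obtain ⟨v, hv, hvX⟩ := this
          exact Finset.mem_image.2 ⟨v, hvX, hv.symm⟩
        have g1 := (Finset.card_le_card hsub).trans Finset.card_image_le
        have hCB : C u ⊆ B u := Finset.filter_subset _ _
        have g2 := Finset.card_sdiff_add_card_eq_card hCB
        have g3 := hBc u hu
        omega
      set H := S.biUnion C with hH
      set S' := S ∪ Finset.univ.filter (fun v => v ∉ X ∧ ∃ u ∈ S, s(u, v) ∈ C u) with hS'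
      have hHS : ∀ e ∈ H, ∀ y ∈ e, y ∈ S' := by
        intro e he y hy
        obtain ⟨u, hu, hue⟩ := Finset.mem_biUnion.1 he
        obtain ⟨g1, ⟨v, rfl⟩, g3, g4⟩ := hCm u e hue
        rcases Sym2.mem_iff.1 hy with rfl | rfl
        · exact Finset.mem_union_left _ hu
        · exact Finset.mem_union_right _
            (Finset.mem_filter.2 ⟨Finset.mem_univ _, g4 _ rfl, u, hu, hue⟩)
      have hS'X : ∀ y ∈ S', y ∈ X → y = x := by
        intro y hy hyX
        rcases Finset.mem_union.1 hy with h | h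
        · exact hSX y h hyX
        · exact absurd hyX (Finset.mem_filter.1 h).2.1
      by_cases hbig : 2 * S.card ≤ S'.card
      · refine ⟨S', Finset.mem_union_left _ hxS, hS'X, ?_, ?_⟩
        · rw [pow_succ]; omega
        · intro v hv
          by_cases hvS : v ∈ S
          · refine ⟨lu v, fu v, h1 v hvS, h2 v hvS, lay_anti r E (by omega) (h3 v hvS),
              h4 v hvS, ?_, (h6 v hvS).trans (Nat.le_succ q)⟩
            intro y hy
            exact (h5 v hvS y hy).imp (fun h => Finset.mem_union_left _ h) id
          · rcases Finset.mem_union.1 hv with h | h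
            · exact absurd h hvS
            · obtain ⟨_, hvX, u, hu, hue⟩ := Finset.mem_filter.1 h
              obtain ⟨g1, g2, g3, g4⟩ := hCm u _ hue
              have hvl : v ∉ u :: lu u := by
                intro hvl
                rcases h5 u hu v hvl with h | h
                · exact hvS h
                · exact hvX h
              refine ⟨u :: lu u, s(u, v), MPath.cons v u _ _ _ (h1 u hu) hvl g3 le_rfl,
                Sym2.mem_mk_right u v, g1, ?_, ?_, ?_⟩
              · have := h4 u hu
                rw [List.length_cons]; omega
              · intro y hy
                rcases List.mem_cons.1 hy with rfl | hy
                · exact Or.inl hv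
                · exact (h5 u hu y hy).imp (fun h => Finset.mem_union_left _ h) id
              · rw [List.toFinset_cons, Finset.insert_sdiff_of_notMem _ hvX]
                exact (Finset.card_insert_le _ _).trans (Nat.succ_le_succ (h6 u hu))
      · exfalso
        apply hno
        have hdc : S.card * (w - K) ≤ H.card * 2 := by
          refine Finset.card_mul_le_card_mul (fun u e => e ∈ C u) ?_ ?_
          · intro u hu
            refine (hCc u hu).trans (Finset.card_le_card ?_)
            intro e he
            exact Finset.mem_filter.2 ⟨Finset.mem_biUnion.2 ⟨u, hu, he⟩, he⟩
          · intro e _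
            induction e with
            | _ y z =>
              refine (Finset.card_le_card (t := {y, z}) ?_).trans Finset.card_le_two
              intro u hu
              have := (hCm u _ (Finset.mem_filter.1 hu).2).2.1
              simpa using this
        have hlc := lay_card r hr H S' hHS m
        have hSpos : 0 < S.card := Finset.card_pos.2 ⟨x, hxS⟩
        have hpos : 0 < (lay r H m).card := by
          have g1 : S.card * (4 * m + 1) ≤ S.card * (w - K) :=
            Nat.mul_le_mul_left _ (by omega)
          have g2 : m * S'.card ≤ m * (2 * S.card) := Nat.mul_le_mul_left _ (by omega)
          by_contra h0
          have h0 : (lay r H m).card = 0 := by omega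
          nlinarith
        obtain ⟨f0, hf0⟩ := Finset.card_pos.1 hpos
        have hf0H := lay_anti r H (Nat.zero_le m) hf0
        obtain ⟨u, hu, hue⟩ := Finset.mem_biUnion.1 hf0H
        obtain ⟨g1, g2, g3, g4⟩ := hCm u _ hue
        obtain ⟨l', u', f', k1, k2, k3, k4⟩ := greedy r H S' hHS a (q + 1) m (lu u) u f0
          ((h1 u hu).mono g3.le) g2 hf0 (by
            have : (u :: lu u).toFinset ∩ S' ⊆ insert x ((u :: lu u).toFinset \ X) := by
              intro y hy
              obtain ⟨hy1, hy2⟩ := Finset.mem_inter.1 hy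
              by_cases hyX : y ∈ X
              · rw [hS'X y hy2 hyX]; exact Finset.mem_insert_self _ _
              · exact Finset.mem_insert_of_mem (Finset.mem_sdiff.2 ⟨hy1, hyX⟩)
            exact (Finset.card_le_card this).trans
              ((Finset.card_insert_le _ _).trans (Nat.succ_le_succ (h6 u hu))))
          (le_trans (Nat.mul_le_mul_left _ (by omega)) hm)
        refine ⟨l', u', f', ?_, k2, k3, ?_⟩
        · have := h4 u hu; omega
        · obtain ⟨u2, _, hue2⟩ := Finset.mem_biUnion.1 k4
          exact lay_anti r E (by omega) (hCm u2 _ hue2).1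
  obtain ⟨S, _, _, hSc, _⟩ := key Q 0 rfl
  have := Finset.card_le_univ S
  omega

lemma iterate_chunk [Fintype V] (r : Sym2 V → α) (hr : Function.Injective r)
    (E : Finset (Sym2 V))
    (a Q K w m : ℕ) (hQ : Fintype.card V < 2 ^ Q) (hm : a * (a + Q) ≤ m)
    (hw : K + 4 * m + 1 ≤ w) (t : ℕ) : ∀ (l : List V) (x : V) (f : Sym2 V),
    MPath r (x :: l) (r f) → x ∈ f → f ∈ lay r E (t * (Q * w)) →
    ∃ (l' : List V) (u' : V) (t' : α), (K ≤ l'.length ∨ l.length + t * a ≤ l'.length) ∧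
        MPath r (u' :: l') t' := by
  induction t with
  | zero => intro l x f h1 _ _; exact ⟨l, x, _, Or.inr (by simp), h1⟩
  | succ t ih =>
    intro l x f h1 h2 h3
    by_cases hlen : (x :: l).length ≤ K
    · obtain ⟨l', u', f', g1, g2, g3, g4⟩ := chunk r hr E a Q K w m (t * (Q * w)) hQ hm hw l x f
        h1 h2 (by rwa [Nat.succ_mul] at h3) hlen
      obtain ⟨l2, u2, t2, k1, k2⟩ := ih l' u' f' g2 g3 g4
      refine ⟨l2, u2, t2, k1.imp id (fun h => ?_), k2⟩
      rw [Nat.succ_mul]; omega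
    · exact ⟨l, x, _, Or.inl (by rw [List.length_cons] at hlen; omega), h1⟩

lemma MPath.toWalk {r : Sym2 V → α} {l : List V} {t : α} (h : MPath r l t) :
    ∃ (u v : V) (p : (⊤ : SimpleGraph V).Walk u v), p.support = l ∧
      List.IsChain (fun e f => r f < r e) p.edges ∧ ∀ e ∈ p.edges.head?, r e ≤ t := by
  induction h with
  | single u t => exact ⟨u, u, SimpleGraph.Walk.nil, by simp, by simp, by simp⟩
  | cons v u l t t' h1 h2 h3 h4 ih =>
    obtain ⟨u0, z, p, hs, hch, hh⟩ := ih
    obtain rfl : u0 = u := by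
      have := p.head_support
      simp only [hs, List.head_cons] at this
      exact this.symm
    have hadj : (⊤ : SimpleGraph V).Adj v u0 := by
      rw [SimpleGraph.top_adj]
      rintro rfl
      exact h2 List.mem_cons_self
    refine ⟨v, z, SimpleGraph.Walk.cons hadj p, by simp [hs], ?_, ?_⟩
    · rw [SimpleGraph.Walk.edges_cons, List.isChain_cons]
      refine ⟨fun e he => ?_, hch⟩
      rw [Sym2.eq_swap]
      exact lt_of_le_of_lt (hh e he) h3
    · intro e he
      simp only [SimpleGraph.Walk.edges_cons, List.head?_cons, Option.mem_def,
        Option.some.injEq] at he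
      rw [← he, Sym2.eq_swap]
      exact h4

lemma MPath.nodup {r : Sym2 V → α} {l : List V} {t : α} (h : MPath r l t) : l.Nodup := by
  induction h with
  | single u t => simp
  | cons v u l t t' h1 h2 h3 h4 ih => exact List.nodup_cons.2 ⟨h2, ih⟩

end Helpers

lemma finite_version (n a Q w : ℕ) (oe : LinearOrder (Sym2 (Fin n))) (hn : n < 2 ^ Q)
    (hw : w = a * a + 4 * (a * (a + Q)) + 1) (hsize : 2 * (a * (Q * w)) + 1 < n) :
    ∃ (u v : Fin n) (p : (⊤ : SimpleGraph (Fin n)).Walk u v),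
      IsMonotonePath ⊤ oe p ∧ a * a ≤ p.length := by
  classical
  let r : Sym2 (Fin n) → Sym2 (Fin n) := id
  have hr : Function.Injective r := fun _ _ h => h
  let E : Finset (Sym2 (Fin n)) := (⊤ : SimpleGraph (Fin n)).edgeFinset
  have hE : E.card = n.choose 2 := by
    have := SimpleGraph.card_edgeFinset_top_eq_card_choose_two (V := Fin n)
    rw [Fintype.card_fin] at this
    rw [← this]
  have hlc := lay_card r hr E Finset.univ (fun _ _ _ _ => Finset.mem_univ _) (a * (Q * w))
  have hpos : 0 < (lay r E (a * (Q * w))).card := by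
    by_contra h0
    have h0 : (lay r E (a * (Q * w))).card = 0 := by omega
    rw [h0, hE, Finset.card_univ, Fintype.card_fin, Nat.choose_two_right] at hlc
    have h2 : n * (n - 1) / 2 * 2 = n * (n - 1) :=
      Nat.div_mul_cancel (Nat.even_mul_pred_self n).two_dvd
    obtain ⟨n', rfl⟩ : ∃ n', n = n' + 1 := ⟨n - 1, by omega⟩
    simp only [Nat.add_sub_cancel] at h2 hlc
    have : (n' + 1) * n' ≤ (n' + 1) * (2 * (a * (Q * w))) := by nlinarith
    have := Nat.le_of_mul_le_mul_left this (Nat.succ_pos n')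
    omega
  obtain ⟨f, hf⟩ := Finset.card_pos.1 hpos
  obtain ⟨x, hx⟩ : ∃ x, x ∈ f := ⟨_, Sym2.out_fst_mem f⟩
  obtain ⟨l', u', t', h1, h2⟩ := iterate_chunk r hr E a Q (a * a) w (a * (a + Q))
    (by simpa using hn) le_rfl hw.ge a [] x f (MPath.single x _) hx hf
  obtain ⟨u, v, p, hs, hch, -⟩ := h2.toWalk
  refine ⟨v, u, p.reverse, ⟨?_, ?_⟩, ?_⟩
  · rw [SimpleGraph.Walk.isPath_reverse_iff, SimpleGraph.Walk.isPath_def, hs]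
    exact h2.nodup
  · rw [SimpleGraph.Walk.edges_reverse]
    exact List.isChain_reverse.2 hch
  · have : p.support.length = p.length + 1 := p.length_support
    rw [hs, List.length_cons] at this
    rw [SimpleGraph.Walk.length_reverse]
    simp only [List.length_nil] at h1
    omega

theorem altitude_complete_graph :
    ∀ ε : ℝ, 0 < ε → ∃ N : ℕ, ∀ n : ℕ, N ≤ n →
      ∀ oe : LinearOrder (Sym2 (Fin n)),
        ∃ (u v : Fin n) (p : (⊤ : SimpleGraph (Fin n)).Walk u v),
          IsMonotonePath ⊤ oe p ∧
            (1 / 20 - ε) * ((n : ℝ) / Real.logb 2 n) ^ ((2 : ℝ) / 3) ≤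
              (p.length : ℝ) := by
  intro ε hε

  have hlit : ∀ᶠ n : ℕ in Filter.atTop, 100000 * (Real.logb 2 n) ^ 4 ≤ (n : ℝ) := by
    have h := (Real.isLittleO_pow_log_id_atTop (n := 4)).comp_tendsto tendsto_natCast_atTop_atTop
    have hl2 : 0 < Real.log 2 := Real.log_pos (by norm_num)
    have h' := h.def (c := (Real.log 2) ^ 4 / 100000) (by positivity)
    filter_upwards [h'] with n hn
    simp only [Function.comp, id, Real.norm_eq_abs, Nat.abs_cast] at hn
    have hn := (le_abs_self _).trans hn
    rw [Real.logb, div_pow]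
    rw [← mul_div_assoc, div_le_iff₀ (by positivity)]
    linarith
  obtain ⟨N, hN⟩ := Filter.eventually_atTop.1 hlit
  refine ⟨max N (2 ^ 20), fun n hn oe => ?_⟩
  have h1 := hN n (le_trans (le_max_left _ _) hn)
  have hn20 : 2 ^ 20 ≤ n := le_trans (le_max_right _ _) hn
  have hn0 : 0 < n := by omega
  set L := Real.logb 2 n with hL
  have hL20 : 20 ≤ L := by
    rw [hL, Real.le_logb_iff_rpow_le (by norm_num) (by positivity)]
    have : ((2 ^ 20 : ℕ) : ℝ) ≤ n := by exact_mod_cast hn20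
    norm_num at this ⊢
    linarith
  set y := (n : ℝ) / L with hy
  have hyL : y * L = n := by rw [hy]; field_simp
  have hy3 : 100000 * L ^ 3 ≤ y := by
    rw [hy, le_div_iff₀ (by linarith)]; linarith
  have hypos : 0 < y := by positivity
  set z := y ^ ((1 : ℝ) / 3) with hz
  have hzpos : 0 < z := by positivity
  have hz3 : z ^ 3 = y := by
    rw [hz, ← Real.rpow_natCast, ← Real.rpow_mul hypos.le]; norm_num
  have hz2 : y ^ ((2 : ℝ) / 3) = z ^ 2 := by
    rw [hz, ← Real.rpow_natCast, ← Real.rpow_mul hypos.le]; norm_num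
  have hzL : 46 * L ≤ z := by
    by_contra hc
    push Not at hc
    have : z ^ 3 < (46 * L) ^ 3 := by gcongr
    rw [hz3] at this
    nlinarith [pow_pos (show 0 < L by linarith) 3]
  set a := ⌊z / 4⌋₊ with ha
  have ha1 : (a : ℝ) ≤ z / 4 := Nat.floor_le (by positivity)
  have ha2 : z / 4 < a + 1 := Nat.lt_floor_add_one _
  set Q := Nat.log 2 n + 1 with hQ
  have hnQ : n < 2 ^ Q := Nat.lt_pow_succ_log_self (by norm_num) n
  have hQL : (Q : ℝ) ≤ L + 1 := by
    have : ((Nat.log 2 n : ℕ) : ℝ) ≤ L := by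
      have := Real.natLog_le_logb n 2
      simpa [hL] using this
    rw [hQ]; push_cast; linarith
  have hQa : (Q : ℝ) ≤ a := by linarith
  have ha10 : (10 : ℝ) ≤ a := by linarith
  obtain ⟨u, v, p, hp, hlen⟩ := finite_version n a Q _ oe hnQ rfl (by
    have hw : ((a : ℝ) * a + 4 * (a * (a + Q)) + 1) ≤ 10 * a ^ 2 := by nlinarith
    have ha3 : (a : ℝ) ^ 3 ≤ y / 64 := by
      have : (a : ℝ) ^ 3 ≤ (z / 4) ^ 3 := by gcongr
      rw [div_pow, hz3] at this
      linarith
    have hQ0 : (0 : ℝ) ≤ Q := Nat.cast_nonneg _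
    have e1 : (a : ℝ) * (Q * (a * a + 4 * (a * (a + Q)) + 1)) ≤ a * (Q * (10 * a ^ 2)) := by
      gcongr
    have e2 : (a : ℝ) * (Q * (10 * a ^ 2)) = 10 * Q * a ^ 3 := by ring
    have e3 : 10 * (Q : ℝ) * a ^ 3 ≤ 10 * (L + 1) * (y / 64) := by gcongr
    have e4 : 10 * (L + 1) * (y / 64) ≤ 10 * (2 * L) * (y / 64) := by gcongr; linarith
    have e5 : 10 * (2 * L) * (y / 64) = 20 / 64 * n := by rw [← hyL]; ring
    have hn20' : ((2 ^ 20 : ℕ) : ℝ) ≤ n := by exact_mod_cast hn20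
    have hn20'' : (1000 : ℝ) ≤ n := by norm_num at hn20' ⊢; exact_mod_cast (by omega : 1000 ≤ n)
    have : (2 * ((a : ℝ) * (Q * (a * a + 4 * (a * (a + Q)) + 1))) + 1) < n := by linarith
    exact_mod_cast this)
  refine ⟨u, v, p, hp, ?_⟩
  rw [hz2]
  have hlen' : (a : ℝ) * a ≤ p.length := by exact_mod_cast hlen
  have hza : z / 4.4 ≤ a := by
    have : (920 : ℝ) ≤ z := by linarith
    norm_num
    linarith
  have : z / 4.4 * (z / 4.4) ≤ a * a := by gcongr
  have h2 : 0 < z ^ 2 := by positivity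
  norm_num at this
  nlinarith

end AltitudePaper
end
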